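/- arXiv:1104.4594 — 2 statements merged into one kernel-verified Lean document; each statement's English description precedes it below -/
import Mathlib

section
/- Let K be a cubic field with prime discriminant −p (p prime). Then the integral trace form of K is, as an integral quadratic form, determined up to equivalence by p: any two cubic fields with discriminant −p have equivalent integral trace forms. -/
open NumberField Module

/-- Two number fields have equivalent integral trace forms if there is a `ℤ`-linear
isomorphism of the rings of integers preserving the trace pairing `(x, y) ↦ tr(x * y)`. -/
def IntTraceEquiv (F L : Type*) [Field F] [NumberField F] [Field L] [NumberField L] : Prop :=
  ∃ e : 𝓞 F ≃ₗ[ℤ] 𝓞 L, ∀ x y : 𝓞 F,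
    Algebra.intTrace ℤ (𝓞 L) (e x * e y) = Algebra.intTrace ℤ (𝓞 F) (x * y)


section Helpers
open Matrix


/-- powers of a Pell solution. -/
lemma pell_pow (D A x Y : ℤ) (h : x ^ 2 - D * Y ^ 2 = 1) (hx : A ∣ x - 1) (hY : A ∣ Y) (K : ℕ) :
    ∃ x' s w : ℤ, x' = x ^ (K + 1) + Y ^ 2 * s ∧
      x' ^ 2 - D * (Y * (((K + 1 : ℕ) : ℤ) * x ^ K + Y ^ 2 * w)) ^ 2 = 1 ∧ A ∣ x' - 1 := by
  induction K with
  | zero =>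
    refine ⟨x, 0, 0, by ring, ?_, hx⟩
    simp; linarith
  | succ K ih =>
    obtain ⟨x', s, w, hx', hp, hA⟩ := ih
    refine ⟨x * x' + D * Y * (Y * (((K + 1 : ℕ) : ℤ) * x ^ K + Y ^ 2 * w)),
      x * s + D * (((K + 1 : ℕ) : ℤ) * x ^ K + Y ^ 2 * w), x * w + s, ?_, ?_, ?_⟩
    · rw [hx']; ring
    · have e : Y * (((K + 1 + 1 : ℕ) : ℤ) * x ^ (K + 1) + Y ^ 2 * (x * w + s))
          = x * (Y * (((K + 1 : ℕ) : ℤ) * x ^ K + Y ^ 2 * w)) + Y * x' := by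
        rw [hx']; push_cast; ring
      rw [e]
      generalize Y * (((K + 1 : ℕ) : ℤ) * x ^ K + Y ^ 2 * w) = Z at *
      linear_combination hp * (x ^ 2 - D * Y ^ 2) + h
    · obtain ⟨u, hu⟩ := hx
      obtain ⟨v, hv⟩ := hA
      obtain ⟨t, ht⟩ := hY
      have e1 : x = 1 + A * u := by linarith
      have e2 : x' = 1 + A * v := by linarith
      generalize (((K + 1 : ℕ) : ℤ) * x ^ K + Y ^ 2 * w) = Z at *
      refine ⟨u + v + A * u * v + D * t * (Y * Z), ?_⟩
      rw [e2]
      nth_rewrite 1 [ht]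
      rw [e1]
      ring

lemma part_decomp (A : ℕ) (n : ℕ) (hn : n ≠ 0) :
    ∃ σ c j : ℕ, n = σ * c ∧ σ ∣ A ^ j ∧ Nat.Coprime c A := by
  induction n using Nat.strong_induction_on with
  | _ n ih =>
    by_cases h : Nat.Coprime n A
    · exact ⟨1, n, 0, by simp, by simp, h⟩
    · have hg : Nat.gcd n A ≠ 1 := h
      obtain ⟨m, hm⟩ := Nat.gcd_dvd_left n A
      have hm0 : m ≠ 0 := by rintro rfl; simp at hm; exact hn hm
      have hg0 : Nat.gcd n A ≠ 0 := by
        intro h0; rw [h0] at hm; simp at hm; exact hn hm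
      have hlt : m < n := by
        have : 2 ≤ Nat.gcd n A := by omega
        have : 2 * m ≤ Nat.gcd n A * m := Nat.mul_le_mul_right _ this
        omega
      obtain ⟨σ, c, j, h1, h2, h3⟩ := ih m hlt hm0
      refine ⟨Nat.gcd n A * σ, c, j + 1, ?_, ?_, h3⟩
      · rw [mul_assoc, ← h1]; exact hm
      · rw [pow_succ, mul_comm]; exact mul_dvd_mul h2 (Nat.gcd_dvd_right n A)

/-- the property: a Pell solution with `Y = τ * c`, `c` coprime to `A`. -/
def PellQ (D A : ℤ) (τ : ℤ) : Prop :=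
  ∃ x c : ℤ, x ^ 2 - D * (τ * c) ^ 2 = 1 ∧ IsCoprime c A ∧ A ∣ x - 1

lemma pellQ_mul (D A τ : ℤ) (K : ℕ) (hK : 0 < K) (hA : A ∣ τ) (hd : (K : ℤ) ∣ τ)
    (h : PellQ D A τ) : PellQ D A (τ * K) := by
  obtain ⟨x, c, h1, h2, h3⟩ := h
  obtain ⟨K, rfl⟩ : ∃ k, K = k + 1 := ⟨K - 1, by omega⟩
  obtain ⟨x', s, w, -, e2, e3⟩ := pell_pow D A x (τ * c) h1 h3 (hA.mul_right c) K
  obtain ⟨t, ht⟩ := hd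
  refine ⟨x', c * (x ^ K + τ * (c ^ 2 * t * w)), ?_, ?_, e3⟩
  · rw [← e2]
    congr 3
    linear_combination (τ ^ 2 * c ^ 3 * w) * ht * (-1)
  · refine IsCoprime.mul_left h2 ?_
    obtain ⟨u, hu⟩ := hA
    have hx : IsCoprime x A := by
      obtain ⟨v, hv⟩ := h3
      exact ⟨1, -v, by linarith⟩
    have := (hx.pow_left (m := K)).add_mul_left_left (u * (c ^ 2 * t * w))
    have e : x ^ K + τ * (c ^ 2 * t * w) = x ^ K + A * (u * (c ^ 2 * t * w)) := by
      linear_combination (c ^ 2 * t * w) * hu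
    rw [e]; exact this

lemma pell_exact_nat (D : ℤ) (hD : 0 < D) (hsq : ¬ IsSquare D) (A : ℕ) (hA : 0 < A) :
    ∃ N0 : ℕ, ∀ N ≥ N0, PellQ D A ((A : ℤ) ^ N) := by
  have hA' : (A : ℤ) ≠ 0 := by exact_mod_cast hA.ne'
  have hsq' : ¬ IsSquare (D * A ^ 2) := by
    rintro ⟨r, hr⟩
    have : (A : ℤ) ∣ r := by
      have : (A : ℤ) ^ 2 ∣ r ^ 2 := ⟨D, by linarith⟩
      exact (Int.pow_dvd_pow_iff (by norm_num)).1 this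
    obtain ⟨t, rfl⟩ := this
    apply hsq
    refine ⟨t, ?_⟩
    have : (A : ℤ) ^ 2 ≠ 0 := pow_ne_zero _ hA'
    apply mul_right_cancel₀ this
    linarith
  obtain ⟨x, y, hxy, hy⟩ := Pell.exists_of_not_isSquare (d := D * A ^ 2) (by positivity) hsq'
  have hx0 : x ≠ 0 := by
    rintro rfl
    have : 0 ≤ D * A ^ 2 * y ^ 2 := by positivity
    linarith
  set Y : ℤ := A * (2 * x * y) with hYdef
  have hY0 : Y ≠ 0 := by simp [hYdef, hA.ne', hx0, hy]
  obtain ⟨σ, c, j, h1, h2, h3⟩ := part_decomp A Y.natAbs (by simpa using hY0)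
  have hYa : (Y.natAbs : ℤ) ^ 2 = Y ^ 2 := by simp
  have hAσ : (A : ℤ) ∣ σ := by
    have : A ∣ σ * c := by
      rw [← h1]
      exact Int.natCast_dvd.1 ⟨_, hYdef⟩
    exact_mod_cast (h3.symm.dvd_of_dvd_mul_right this)
  have q0 : PellQ D A σ := by
    refine ⟨x ^ 2 + D * A ^ 2 * y ^ 2, c, ?_, ?_, ?_⟩
    · have : ((σ : ℤ) * c) ^ 2 = Y ^ 2 := by rw [← hYa, h1]; push_cast; ring
      rw [this, hYdef]
      linear_combination (x ^ 2 - D * A ^ 2 * y ^ 2 + 1) * hxy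
    · exact Nat.isCoprime_iff_coprime.2 h3
    · refine ⟨2 * D * A * y ^ 2, ?_⟩
      linear_combination hxy
  have q1 : ∀ i : ℕ, PellQ D A (σ * A ^ i) := by
    intro i
    induction i with
    | zero => simpa using q0
    | succ i ih =>
      have := pellQ_mul D A (σ * A ^ i) A hA (hAσ.mul_right _) (hAσ.mul_right _) ih
      rwa [pow_succ, ← mul_assoc]
  refine ⟨2 * j, fun N hN => ?_⟩
  obtain ⟨K, hK⟩ := h2
  have hK0 : 0 < K := by
    rcases Nat.eq_zero_or_pos K with rfl | h
    · simp at hK; omega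
    · exact h
  have := pellQ_mul D A (σ * A ^ (N - j)) K hK0 (hAσ.mul_right _) (by
    have : (K : ℤ) ∣ (A : ℤ) ^ (N - j) := by
      have e : A ^ (N - j) = A ^ j * A ^ (N - j - j) := by rw [← pow_add]; congr 1; omega
      exact_mod_cast (e ▸ hK ▸ ((Dvd.intro_left σ rfl).mul_right _) : K ∣ A ^ (N - j))
    exact this.mul_left _) (q1 (N - j))
  convert this using 1
  have e : A ^ N = A ^ j * A ^ (N - j) := by rw [← pow_add]; congr 1; omega
  have e2 : (A : ℤ) ^ N = σ * K * A ^ (N - j) := by exact_mod_cast (hK ▸ e)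
  rw [e2]; ring

/-- Pell solutions with exact `A`-part of `Y`. -/
lemma pell_exact (D : ℤ) (hD : 0 < D) (hsq : ¬ IsSquare D) (A : ℤ) (hA : A ≠ 0) :
    ∃ N0 : ℕ, ∀ N ≥ N0, ∃ x y : ℤ, x ^ 2 - D * (A ^ N * y) ^ 2 = 1 ∧ IsCoprime y A ∧
      A ∣ x - 1 := by
  obtain ⟨N0, h⟩ := pell_exact_nat D hD hsq A.natAbs (Int.natAbs_pos.2 hA)
  refine ⟨N0, fun N hN => ?_⟩
  obtain ⟨x, c, h1, h2, h3⟩ := h N hN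
  refine ⟨x, c, ?_, ?_, ?_⟩
  · rw [← h1, mul_pow, mul_pow, ← pow_mul, ← pow_mul, mul_comm N 2, pow_mul, pow_mul]
    simp
  · rcases Int.natAbs_eq A with h | h <;> rw [h]
    · exact h2
    · exact h2.neg_right
  · exact Int.natAbs_dvd.1 h3

/-- scaling of the `y` residue. -/
lemma pell_scale (D A x y : ℤ) (N : ℕ) (h : x ^ 2 - D * (A ^ (N + 1) * y) ^ 2 = 1)
    (hx : A ∣ x - 1) (K : ℕ) :
    ∃ x' y' : ℤ, x' ^ 2 - D * (A ^ (N + 1) * y') ^ 2 = 1 ∧ A ∣ x' - 1 ∧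
      A ∣ y' - ((K + 1 : ℕ) : ℤ) * y := by
  obtain ⟨x', s, w, -, e2, e3⟩ := pell_pow D A x (A ^ (N + 1) * y) h hx
    ((dvd_pow_self A (by omega)).mul_right _) K
  refine ⟨x', y * (((K + 1 : ℕ) : ℤ) * x ^ K + (A ^ (N + 1) * y) ^ 2 * w), ?_, e3, ?_⟩
  · rw [← e2]; ring
  · have hk : A ∣ x ^ K - 1 := hx.trans (by simpa using sub_dvd_pow_sub_pow x 1 K)
    obtain ⟨t, ht⟩ := hk
    refine ⟨y * ((K + 1 : ℕ) : ℤ) * t + y * (A ^ N * y) * (A ^ (N + 1) * y) * w, ?_⟩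
    linear_combination y * ((K + 1 : ℕ) : ℤ) * ht



/-- Symmetric matrix. -/
def symM (a b c d e f : ℤ) : Matrix (Fin 3) (Fin 3) ℤ := !![a, b, c; b, d, e; c, e, f]

/-- cross product type operator attached to `m`. -/
def rotX (a b c d e f : ℤ) (m : Fin 3 → ℤ) : Matrix (Fin 3) (Fin 3) ℤ :=
  !![0, -(c * m 0 + e * m 1 + f * m 2), b * m 0 + d * m 1 + e * m 2;
     c * m 0 + e * m 1 + f * m 2, 0, -(a * m 0 + b * m 1 + c * m 2);
     -(b * m 0 + d * m 1 + e * m 2), a * m 0 + b * m 1 + c * m 2, 0] * symM a b c d e f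

/-- the bilinear form. -/
def bil (G : Matrix (Fin 3) (Fin 3) ℤ) (u v : Fin 3 → ℤ) : ℤ := u ⬝ᵥ (G *ᵥ v)

lemma rotX_skew (a b c d e f : ℤ) (m : Fin 3 → ℤ) :
    (rotX a b c d e f m)ᵀ * symM a b c d e f = - (symM a b c d e f * rotX a b c d e f m) := by
  ext i j
  fin_cases i <;> fin_cases j <;>
    simp [rotX, symM, Matrix.mul_apply, Fin.sum_univ_three] <;> ring

lemma symM_mulVec (a b c d e f : ℤ) (m : Fin 3 → ℤ) :
    symM a b c d e f *ᵥ m = ![a * m 0 + b * m 1 + c * m 2, b * m 0 + d * m 1 + e * m 2,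
      c * m 0 + e * m 1 + f * m 2] := by
  ext i
  fin_cases i <;> simp [symM, Matrix.mulVec, dotProduct, Fin.sum_univ_three]

lemma bil_symM (a b c d e f : ℤ) (u m : Fin 3 → ℤ) :
    bil (symM a b c d e f) u m = u 0 * (a * m 0 + b * m 1 + c * m 2)
      + u 1 * (b * m 0 + d * m 1 + e * m 2) + u 2 * (c * m 0 + e * m 1 + f * m 2) := by
  rw [bil, symM_mulVec]; simp [dotProduct, Fin.sum_univ_three]

lemma symM_det (a b c d e f : ℤ) :
    (symM a b c d e f).det = a * d * f - a * e * e - b * b * f + b * e * c + c * b * e - c * d * c := by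
  simp [symM, Matrix.det_fin_three]

lemma rotX_sq (a b c d e f : ℤ) (m : Fin 3 → ℤ) :
    rotX a b c d e f m * rotX a b c d e f m =
      (-(symM a b c d e f).det) • (bil (symM a b c d e f) m m • (1 : Matrix (Fin 3) (Fin 3) ℤ)
        - Matrix.vecMulVec m (symM a b c d e f *ᵥ m)) := by
  rw [symM_det, bil_symM, symM_mulVec]
  ext i j
  simp only [rotX, symM, Matrix.mul_apply, Fin.sum_univ_three, Matrix.smul_apply, Matrix.sub_apply,
    Matrix.vecMulVec_apply, Matrix.one_apply, smul_eq_mul]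
  fin_cases i <;> fin_cases j <;>
    simp only [Fin.zero_eta, Fin.mk_one, Fin.reduceFinMk, Matrix.of_apply, Matrix.cons_val,
      Matrix.cons_val_zero, Matrix.cons_val_one, if_true, Fin.reduceEq, if_false] <;> ring

lemma rotX_self (a b c d e f : ℤ) (m : Fin 3 → ℤ) : rotX a b c d e f m *ᵥ m = 0 := by
  ext i
  fin_cases i <;>
    simp [rotX, symM, Matrix.mul_apply, Fin.sum_univ_three, dotProduct, Matrix.mulVec] <;> ring

/-- the integral rotation. -/
lemma exists_rot (a b c d e f : ℤ) (m : Fin 3 → ℤ) (x y : ℤ)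
    (h : x ^ 2 + (symM a b c d e f).det * bil (symM a b c d e f) m m * y ^ 2 = 1) :
    ∃ R R' : Matrix (Fin 3) (Fin 3) ℤ, Rᵀ * symM a b c d e f * R = symM a b c d e f ∧
      R'ᵀ * symM a b c d e f * R' = symM a b c d e f ∧ R' * R = 1 ∧
      ∀ z, R *ᵥ z = z + (2 * x * y) • (rotX a b c d e f m *ᵥ z)
        - (2 * y ^ 2 * (symM a b c d e f).det) • (bil (symM a b c d e f) m m • z
          - bil (symM a b c d e f) m z • m) := by
  set G := symM a b c d e f with hG
  set X := rotX a b c d e f m with hX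
  have hGs : Gᵀ = G := by
    rw [hG]; ext i j; fin_cases i <;> fin_cases j <;> simp [symM]
  have hsk : Xᵀ * G = - (G * X) := rotX_skew a b c d e f m
  have hsq : X * X = (-G.det) • (bil G m m • (1 : Matrix (Fin 3) (Fin 3) ℤ)
        - Matrix.vecMulVec m (G *ᵥ m)) := rotX_sq a b c d e f m
  have hself : X *ᵥ m = 0 := rotX_self a b c d e f m
  have h3 : X * (X * X) = (-(G.det * bil G m m)) • X := by
    rw [hsq]
    rw [Matrix.mul_smul, Matrix.mul_sub, Matrix.mul_vecMulVec, hself]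
    rw [Matrix.mul_smul, Matrix.mul_one, Matrix.zero_vecMulVec, sub_zero, smul_smul, neg_mul]
  have h4 : X * X * (X * X) = (-(G.det * bil G m m)) • (X * X) := by
    rw [Matrix.mul_assoc, h3, Matrix.mul_smul]
  -- generic
  have key : ∀ s t : ℤ, s * s = t * t → s * t = -(x * x) →
      (1 + (2 * s * y) • X + (2 * y ^ 2) • (X * X)) *
        (1 + (2 * t * y) • X + (2 * y ^ 2) • (X * X)) = 1 + (2 * s * y + 2 * t * y) • X
          + ((2 * s * y) * (2 * y ^ 2) + (2 * t * y) * (2 * y ^ 2)) • (X * (X * X)) := by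
    intro s t _ hst
    have e : (1 + (2 * s * y) • X + (2 * y ^ 2) • (X * X)) *
        (1 + (2 * t * y) • X + (2 * y ^ 2) • (X * X)) =
        1 + (2 * s * y + 2 * t * y) • X
          + ((2 * s * y) * (2 * y ^ 2) + (2 * t * y) * (2 * y ^ 2)) • (X * (X * X))
          + (4 * y ^ 2 + (2 * s * y) * (2 * t * y)) • (X * X)
          + (4 * y ^ 4) • (X * X * (X * X)) := by
      simp only [Matrix.mul_add, Matrix.add_mul, Matrix.mul_smul, Matrix.smul_mul, Matrix.one_mul,
        Matrix.mul_one, Matrix.mul_assoc]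
      module
    rw [e, h4, smul_smul, add_assoc, ← add_smul]
    have : 4 * y ^ 2 + 2 * s * y * (2 * t * y) + 4 * y ^ 4 * -(G.det * bil G m m) = 0 := by
      linear_combination (4 * y ^ 2) * hst - 4 * y ^ 2 * h
    rw [this]; simp
  have hinv : ∀ s : ℤ, s * s = x * x →
      (1 + (2 * (-s) * y) • X + (2 * y ^ 2) • (X * X)) *
        (1 + (2 * s * y) • X + (2 * y ^ 2) • (X * X)) = 1 := by
    intro s hs
    rw [key (-s) s (by ring) (by linear_combination -hs)]
    have : 2 * (-s) * y + 2 * s * y = 0 := by ring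
    rw [this]
    have : 2 * (-s) * y * (2 * y ^ 2) + 2 * s * y * (2 * y ^ 2) = 0 := by ring
    rw [this]; simp
  have hT : ∀ s : ℤ, (1 + (2 * s * y) • X + (2 * y ^ 2) • (X * X))ᵀ * G
      = G * (1 + (2 * (-s) * y) • X + (2 * y ^ 2) • (X * X)) := by
    intro s
    have e2 : Xᵀ * (Xᵀ * G) = G * (X * X) := by
      rw [hsk, Matrix.mul_neg, ← Matrix.mul_assoc, hsk]; simp [Matrix.mul_assoc]
    simp only [Matrix.transpose_add, Matrix.transpose_one, Matrix.transpose_smul,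
      Matrix.transpose_mul, Matrix.add_mul, Matrix.smul_mul, Matrix.one_mul, Matrix.mul_add,
      Matrix.mul_one, Matrix.mul_smul, Matrix.mul_assoc, e2]
    rw [hsk]
    module
  have haut : ∀ s : ℤ, s * s = x * x → (1 + (2 * s * y) • X + (2 * y ^ 2) • (X * X))ᵀ * G *
      (1 + (2 * s * y) • X + (2 * y ^ 2) • (X * X)) = G := by
    intro s hs
    rw [hT, Matrix.mul_assoc, hinv s hs, Matrix.mul_one]
  refine ⟨_, _, haut x rfl, haut (-x) (by ring), hinv x rfl, ?_⟩
  intro z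
  rw [hsq]
  simp only [Matrix.add_mulVec, Matrix.sub_mulVec, Matrix.smul_mulVec, Matrix.one_mulVec,
    Matrix.vecMulVec_mulVec]
  have : (G *ᵥ m) ⬝ᵥ z = bil G m z := by
    unfold bil
    rw [Matrix.dotProduct_mulVec, ← Matrix.mulVec_transpose, hGs]
  rw [this]
  ext i
  simp
  ring


/-- approximate rotation. -/
lemma rot_apply (a b c d e f : ℤ) (A p x t μ : ℤ) (v w m z : Fin 3 → ℤ)
    (hm : m = μ • v + A • w) (hdet : (symM a b c d e f).det = -p)
    (hq : A ∣ bil (symM a b c d e f) m m) (hx : A ∣ x - 1)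
    (h : x ^ 2 - p * bil (symM a b c d e f) m m * t ^ 2 = 1) :
    ∃ R R' : Matrix (Fin 3) (Fin 3) ℤ, Rᵀ * symM a b c d e f * R = symM a b c d e f ∧
      R'ᵀ * symM a b c d e f * R' = symM a b c d e f ∧ R' * R = 1 ∧
      ∃ r, R *ᵥ z = z + (2 * (t * μ)) • (rotX a b c d e f v *ᵥ z)
        - (2 * p * (t * μ) ^ 2 * bil (symM a b c d e f) v z) • v + A • r := by
  obtain ⟨R, R', h1, h2, h3, h4⟩ := exists_rot a b c d e f m x t (by rw [hdet]; linarith)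
  refine ⟨R, R', h1, h2, h3, ?_⟩
  rw [h4 z, hdet]
  obtain ⟨k, hk⟩ := hq
  obtain ⟨l, hl⟩ := hx
  have hx' : x = 1 + A * l := by linarith
  have hX : rotX a b c d e f m *ᵥ z = μ • (rotX a b c d e f v *ᵥ z)
      + A • (rotX a b c d e f w *ᵥ z) := by
    have : rotX a b c d e f m = μ • rotX a b c d e f v + A • rotX a b c d e f w := by
      unfold rotX
      rw [← Matrix.smul_mul, ← Matrix.smul_mul, ← Matrix.add_mul, hm]
      congr 1
      ext i j
      fin_cases i <;> fin_cases j <;> simp <;> ring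
    rw [this, Matrix.add_mulVec, Matrix.smul_mulVec, Matrix.smul_mulVec]
  have hb : bil (symM a b c d e f) m z = μ * bil (symM a b c d e f) v z
      + A * bil (symM a b c d e f) w z := by
    rw [hm]; simp only [bil, add_dotProduct, smul_dotProduct, smul_eq_mul]
  rw [hX, hb, hk, hx']
  generalize bil (symM a b c d e f) v z = β
  generalize bil (symM a b c d e f) w z = γ
  generalize rotX a b c d e f v *ᵥ z = V
  generalize rotX a b c d e f w *ᵥ z = W
  refine ⟨(2 * l * t * μ) • V + (2 * (1 + A * l) * t) • W + (2 * t ^ 2 * p * k) • z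
    - (2 * t ^ 2 * p * γ) • m - (2 * t ^ 2 * p * μ * β) • w, ?_⟩
  rw [hm]
  module

/-- The trace Gram matrix attached to a binary cubic form. -/
abbrev GM (a b c d : ℤ) : Matrix (Fin 3) (Fin 3) ℤ :=
  symM 3 b (-c) (b ^ 2 - 2 * a * c) (-(3 * a * d)) (c ^ 2 - 2 * b * d)

lemma GM_det (a b c d : ℤ) : (GM a b c d).det =
    b ^ 2 * c ^ 2 - 4 * a * c ^ 3 - 4 * b ^ 3 * d - 27 * a ^ 2 * d ^ 2 + 18 * a * b * c * d := by
  rw [symM_det]; ring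

/-- `f`-sequence property -/
def SeqF (a b c d : ℤ) (j : ℕ) : Prop :=
  ∃ y z μ r s : ℤ, (b ^ 2 - 3 * a * c) * y ^ 2 + (b * c - 9 * a * d) * y * z
      + (c ^ 2 - 3 * b * d) * z ^ 2 = (b ^ 2 - 3 * a * c) ^ j ∧
    IsCoprime μ (b ^ 2 - 3 * a * c) ∧ y = μ * b + (b ^ 2 - 3 * a * c) * r ∧
    z = μ * (-(3 * a)) + (b ^ 2 - 3 * a * c) * s

/-- `e`-sequence property -/
def SeqE (a b c d : ℤ) (j : ℕ) : Prop :=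
  ∃ y z μ r s : ℤ, (b ^ 2 - 3 * a * c) * y ^ 2 + (b * c - 9 * a * d) * y * z
      + (c ^ 2 - 3 * b * d) * z ^ 2 = (b ^ 2 - 3 * a * c) ^ j ∧
    IsCoprime μ (b ^ 2 - 3 * a * c) ∧ y = μ + (b ^ 2 - 3 * a * c) * r ∧
    z = (b ^ 2 - 3 * a * c) * s

lemma seqF_zero (a b c d : ℤ) : SeqF a b c d 2 :=
  ⟨b, -(3 * a), 1, 0, 0, by ring, isCoprime_one_left, by ring, by ring⟩

lemma seqE_zero (a b c d : ℤ) : SeqE a b c d 1 :=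
  ⟨1, 0, 1, 0, 0, by ring, isCoprime_one_left, by ring, by ring⟩

lemma seqF_succ (a b c d : ℤ) (j : ℕ) (h : SeqF a b c d j)
    (hB : IsCoprime (-(3 * a * (b * c - 9 * a * d))) (b ^ 2 - 3 * a * c)) :
    SeqF a b c d (j + 3) := by
  obtain ⟨y, z, μ, r, s, h1, h2, h3, h4⟩ := h
  refine ⟨(b ^ 2 - 3 * a * c) * b * y + 3 * a * (c ^ 2 - 3 * b * d) * z,
    -(3 * a * (b ^ 2 - 3 * a * c)) * y
      + ((b ^ 2 - 3 * a * c) * b - 3 * a * (b * c - 9 * a * d)) * z,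
    -(3 * a * (b * c - 9 * a * d)) * μ, b * y + 3 * a * (c ^ 2 - 3 * b * d) * s + 3 * a * μ * c,
    -(3 * a) * y + b * z - 3 * a * (b * c - 9 * a * d) * s, ?_, hB.mul_left h2, ?_, ?_⟩
  · rw [pow_add, ← h1]; ring
  · rw [h4]; ring
  · rw [h4]; ring

lemma seqE_succ (a b c d : ℤ) (j : ℕ) (h : SeqE a b c d j)
    (hB : IsCoprime (-(3 * a * (b * c - 9 * a * d))) (b ^ 2 - 3 * a * c)) :
    SeqE a b c d (j + 3) := by
  obtain ⟨y, z, μ, r, s, h1, h2, h3, h4⟩ := h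
  refine ⟨((b ^ 2 - 3 * a * c) * b - 3 * a * (b * c - 9 * a * d)) * y
      - 3 * a * (c ^ 2 - 3 * b * d) * z,
    3 * a * (b ^ 2 - 3 * a * c) * y + (b ^ 2 - 3 * a * c) * b * z,
    -(3 * a * (b * c - 9 * a * d)) * μ,
    b * y - 3 * a * (b * c - 9 * a * d) * r - 3 * a * (c ^ 2 - 3 * b * d) * s,
    3 * a * y + b * z, ?_, hB.mul_left h2, ?_, ?_⟩
  · rw [pow_add, ← h1]; ring
  · rw [h4, h3]; ring
  · ring

lemma seqF_all (a b c d : ℤ)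
    (hB : IsCoprime (-(3 * a * (b * c - 9 * a * d))) (b ^ 2 - 3 * a * c)) (k : ℕ) :
    SeqF a b c d (2 * (3 * k + 1)) := by
  induction k with
  | zero => exact seqF_zero a b c d
  | succ k ih => exact seqF_succ _ _ _ _ _ (seqF_succ _ _ _ _ _ ih hB) hB

lemma seqE_all (a b c d : ℤ)
    (hB : IsCoprime (-(3 * a * (b * c - 9 * a * d))) (b ^ 2 - 3 * a * c)) (k : ℕ) :
    SeqE a b c d (2 * (3 * k + 2)) := by
  induction k with
  | zero => exact seqE_succ _ _ _ _ _ (seqE_zero a b c d) hB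
  | succ k ih => exact seqE_succ _ _ _ _ _ (seqE_succ _ _ _ _ _ ih hB) hB

/-- trace zero vector attached to `(y, z)`. -/
def hat (b c y z : ℤ) : Fin 3 → ℤ := ![-b * y + c * z, 3 * y, 3 * z]

lemma hat_q (a b c d y z : ℤ) : bil (GM a b c d) (hat b c y z) (hat b c y z) =
    6 * ((b ^ 2 - 3 * a * c) * y ^ 2 + (b * c - 9 * a * d) * y * z
      + (c ^ 2 - 3 * b * d) * z ^ 2) := by
  rw [bil_symM]; simp [hat]; ring

lemma hat_lin (b c y z y' z' μ A : ℤ) :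
    hat b c (μ * y + A * y') (μ * z + A * z') = μ • hat b c y z + A • hat b c y' z' := by
  ext i; fin_cases i <;> simp [hat] <;> ring

lemma X_vu (a b c d p : ℤ) (h : (GM a b c d).det = -p) :
    rotX 3 b (-c) (b ^ 2 - 2 * a * c) (-(3 * a * d)) (c ^ 2 - 2 * b * d) (hat b c 1 0)
      *ᵥ (hat b c b (-(3 * a))) = ![9 * a * p, 0, 0] := by
  rw [GM_det] at h
  have : p = -(b ^ 2 * c ^ 2 - 4 * a * c ^ 3 - 4 * b ^ 3 * d - 27 * a ^ 2 * d ^ 2 + 18 * a * b * c * d) := by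
    linarith
  rw [this, rotX, ← Matrix.mulVec_mulVec, symM_mulVec]
  ext i; fin_cases i <;> simp [hat, Matrix.mulVec, dotProduct, Fin.sum_univ_three] <;> ring

lemma X_uv (a b c d p : ℤ) (h : (GM a b c d).det = -p) :
    rotX 3 b (-c) (b ^ 2 - 2 * a * c) (-(3 * a * d)) (c ^ 2 - 2 * b * d) (hat b c b (-(3 * a)))
      *ᵥ (hat b c 1 0) = ![-(9 * a * p), 0, 0] := by
  rw [GM_det] at h
  have : p = -(b ^ 2 * c ^ 2 - 4 * a * c ^ 3 - 4 * b ^ 3 * d - 27 * a ^ 2 * d ^ 2 + 18 * a * b * c * d) := by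
    linarith
  rw [this, rotX, ← Matrix.mulVec_mulVec, symM_mulVec]
  ext i; fin_cases i <;> simp [hat, Matrix.mulVec, dotProduct, Fin.sum_univ_three] <;> ring

lemma bil_vu (a b c d : ℤ) : bil (GM a b c d) (hat b c 1 0) (hat b c b (-(3 * a))) =
    3 * (2 * b ^ 3 - 9 * a * b * c + 27 * a ^ 2 * d) := by
  rw [bil_symM]; simp [hat]; ring

lemma bil_uv (a b c d : ℤ) : bil (GM a b c d) (hat b c b (-(3 * a))) (hat b c 1 0) =
    3 * (2 * b ^ 3 - 9 * a * b * c + 27 * a ^ 2 * d) := by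
  rw [bil_symM]; simp [hat]; ring

/-- positive inverse mod `A`. -/
lemma exists_nat_inv (A u : ℤ) (hA : A ≠ 0) (h : IsCoprime u A) :
    ∃ K : ℕ, A ∣ ((K + 1 : ℕ) : ℤ) * u - 1 := by
  obtain ⟨s, t, hst⟩ := h
  have h1 : 0 ≤ s % A := Int.emod_nonneg _ hA
  have h2 : 0 < |A| := abs_pos.2 hA
  refine ⟨(s % A + |A| - 1).toNat, ?_⟩
  have e : (((s % A + |A| - 1).toNat + 1 : ℕ) : ℤ) = s % A + |A| := by
    push_cast
    rw [Int.toNat_of_nonneg (by linarith)]; ring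
  rw [e]
  have e2 : s % A = s - A * (s / A) := Int.emod_def s A
  obtain ⟨k, hk⟩ : A ∣ |A| := (dvd_abs A A).2 dvd_rfl
  rw [e2, hk]
  exact ⟨-t - (s / A) * u + k * u, by linear_combination hst⟩


lemma cop_B (a b c d p : ℤ) (hdet : (GM a b c d).det = -p)
    (hA : IsCoprime (6 * p) (b ^ 2 - 3 * a * c)) :
    IsCoprime (b * c - 9 * a * d) (b ^ 2 - 3 * a * c) := by
  rw [GM_det] at hdet
  have h3 : IsCoprime (3 * p) (b ^ 2 - 3 * a * c) := by
    have : (6 : ℤ) * p = 2 * (3 * p) := by ring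
    rw [this] at hA
    exact hA.of_mul_left_right
  have := h3.add_mul_left_left (4 * (c ^ 2 - 3 * b * d))
  have e : 3 * p + (b ^ 2 - 3 * a * c) * (4 * (c ^ 2 - 3 * b * d)) =
      (b * c - 9 * a * d) * (b * c - 9 * a * d) := by linear_combination 3 * hdet
  rw [e] at this
  exact this.of_mul_left_left

lemma cop_a (a b c d p : ℤ) (hdet : (GM a b c d).det = -p)
    (hA : IsCoprime (6 * p) (b ^ 2 - 3 * a * c)) :
    IsCoprime a (b ^ 2 - 3 * a * c) := by
  rw [GM_det] at hdet
  have h3 : IsCoprime p (b ^ 2 - 3 * a * c) := hA.of_mul_left_right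
  have := h3.add_mul_left_left (c ^ 2 - 4 * b * d)
  have e : p + (b ^ 2 - 3 * a * c) * (c ^ 2 - 4 * b * d) =
      a * (- (3 * c * (c ^ 2 - 4 * b * d) - 4 * c ^ 3 - 27 * a * d ^ 2 + 18 * b * c * d)) := by
    linear_combination hdet
  rw [e] at this
  exact this.of_mul_left_left

lemma cop_g (a b c d p : ℤ) (hdet : (GM a b c d).det = -p)
    (hA : IsCoprime (6 * p) (b ^ 2 - 3 * a * c)) :
    IsCoprime (2 * b ^ 3 - 9 * a * b * c + 27 * a ^ 2 * d) (b ^ 2 - 3 * a * c) := by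
  have h3 : IsCoprime 3 (b ^ 2 - 3 * a * c) := by
    have : (6 : ℤ) * p = 3 * (2 * p) := by ring
    rw [this] at hA
    exact hA.of_mul_left_left
  have := ((h3.neg_left.mul_left (cop_a a b c d p hdet hA)).mul_left
    (cop_B a b c d p hdet hA)).add_mul_left_left (2 * b)
  have e : -3 * a * (b * c - 9 * a * d) + (b ^ 2 - 3 * a * c) * (2 * b)
    = 2 * b ^ 3 - 9 * a * b * c + 27 * a ^ 2 * d := by ring
  rwa [e] at this

lemma aut_exists (a b c d p : ℤ) (hp : 0 < p) (hsq : ¬ IsSquare (6 * p))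
    (hdet : (GM a b c d).det = -p)
    (hA : IsCoprime (6 * p) (b ^ 2 - 3 * a * c)) (hA0 : b ^ 2 - 3 * a * c ≠ 0) :
    ∃ g : Matrix (Fin 3) (Fin 3) ℤ, gᵀ * GM a b c d * g = GM a b c d ∧
      ∃ (κ : ℤ) (r : Fin 3 → ℤ), IsCoprime κ (b ^ 2 - 3 * a * c) ∧
        g *ᵥ (hat b c b (-(3 * a))) = κ • hat b c 1 0 + (b ^ 2 - 3 * a * c) • r := by
  have cg := cop_g a b c d p hdet hA
  have hB : IsCoprime (-(3 * a * (b * c - 9 * a * d))) (b ^ 2 - 3 * a * c) := by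
    have h3 : IsCoprime 3 (b ^ 2 - 3 * a * c) := by
      have : (6 : ℤ) * p = 3 * (2 * p) := by ring
      rw [this] at hA
      exact hA.of_mul_left_left
    exact ((h3.mul_left (cop_a a b c d p hdet hA)).mul_left (cop_B a b c d p hdet hA)).neg_left
  obtain ⟨N0, hN0⟩ := pell_exact (6 * p) (by linarith) hsq (b ^ 2 - 3 * a * c) hA0
  obtain ⟨y₁, z₁, μ₁, r₁, s₁, hE1, hE2, hE3, hE4⟩ := seqE_all a b c d hB N0
  obtain ⟨y₂, z₂, μ₂, r₂, s₂, hF1, hF2, hF3, hF4⟩ := seqF_all a b c d hB N0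
  obtain ⟨X₁, T₁, hP1, hT1, hX1⟩ := hN0 (3 * N0 + 2) (by omega)
  obtain ⟨X₂, T₂, hP2, hT2, hX2⟩ := hN0 (3 * N0 + 1) (by omega)
  have hq1 := hat_q a b c d y₁ z₁
  rw [hE1] at hq1
  have hq2 := hat_q a b c d y₂ z₂
  rw [hF1] at hq2
  have xvu := X_vu a b c d p hdet
  have xuv := X_uv a b c d p hdet
  have bvu := bil_vu a b c d
  have buv := bil_uv a b c d
  have hm1 : hat b c y₁ z₁ = μ₁ • hat b c 1 0 + (b ^ 2 - 3 * a * c) • hat b c r₁ s₁ := by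
    rw [← hat_lin, hE3, hE4]; congr 1 <;> ring
  have hm2 : hat b c y₂ z₂ = μ₂ • hat b c b (-(3 * a)) + (b ^ 2 - 3 * a * c) • hat b c r₂ s₂ := by
    rw [← hat_lin, hF3, hF4]
  set A := b ^ 2 - 3 * a * c with hAdef
  set g := 2 * b ^ 3 - 9 * a * b * c + 27 * a ^ 2 * d with hg
  have hunit : IsCoprime (6 * p * g * (T₁ * μ₁) * (T₂ * μ₂)) A :=
    ((hA.mul_left cg).mul_left (hT1.mul_left hE2)).mul_left (hT2.mul_left hF2)
  obtain ⟨K, hK⟩ := exists_nat_inv A _ hA0 hunit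
  obtain ⟨X₁', T₁', hP1', hX1', hT1'⟩ := pell_scale (6 * p) A X₁ T₁ (3 * N0 + 1) hP1 hX1 K
  obtain ⟨i, hi⟩ := hK
  obtain ⟨j, hj⟩ := hT1'
  have hcong : 6 * p * g * (T₁' * μ₁) * (T₂ * μ₂) = 1 + A * (i + 6 * p * g * μ₁ * T₂ * μ₂ * j) := by
    linear_combination hi + 6 * p * g * μ₁ * T₂ * μ₂ * hj
  obtain ⟨R, -, hR, -, -, r, hr⟩ := rot_apply _ _ _ _ _ _ A p X₁' T₁' μ₁ (hat b c 1 0)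
    (hat b c r₁ s₁) _ (hat b c b (-(3 * a))) hm1 hdet (by
      rw [hq1]; exact (dvd_pow_self A (by omega)).mul_left _) hX1' (by
      rw [hq1, ← hP1', mul_pow, ← pow_mul, Nat.mul_comm 2]; ring)
  obtain ⟨S, S', hS, hS', hSS, s, hs⟩ := rot_apply _ _ _ _ _ _ A p X₂ T₂ μ₂ (hat b c b (-(3 * a)))
    (hat b c r₂ s₂) _ (hat b c 1 0) hm2 hdet (by
      rw [hq2]; exact (dvd_pow_self A (by omega)).mul_left _) hX2 (by
      rw [hq2, ← hP2, mul_pow, ← pow_mul, Nat.mul_comm 2]; ring)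
  rw [xvu, bvu] at hr
  rw [xuv, buv] at hs
  have hTμ : IsCoprime (6 * p * g * (T₁' * μ₁)) A := by
    have : IsCoprime (6 * p * g * (T₁' * μ₁) * (T₂ * μ₂)) A := by
      rw [hcong]; exact isCoprime_one_left.add_mul_left_left _
    exact this.of_mul_left_left
  generalize T₁' * μ₁ = Y at *
  generalize T₂ * μ₂ = Z at *
  generalize i + 6 * p * g * μ₁ * T₂ * μ₂ * j = l at *
  refine ⟨S' * R, ?_, -(6 * p * g * Y ^ 2), S' *ᵥ (r - (-(6 * p * g * Y ^ 2)) • s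
      + ![-(18 * a * p * Y * l), 0, 0] - (2 * l + A * l ^ 2) • hat b c b (-(3 * a))), ?_, ?_⟩
  · rw [Matrix.transpose_mul]
    calc Rᵀ * S'ᵀ * GM a b c d * (S' * R) = Rᵀ * (S'ᵀ * GM a b c d * S') * R := by
          simp only [Matrix.mul_assoc]
      _ = _ := by rw [hS', hR]
  · have := hTμ.mul_left hTμ.of_mul_left_right
    have e : 6 * p * g * Y ^ 2 = 6 * p * g * Y * Y := by ring
    rw [e]; exact this.neg_left
  · have e : R *ᵥ (hat b c b (-(3 * a))) = (-(6 * p * g * Y ^ 2)) • (S *ᵥ hat b c 1 0)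
      + A • (r - (-(6 * p * g * Y ^ 2)) • s
      + ![-(18 * a * p * Y * l), 0, 0] - (2 * l + A * l ^ 2) • hat b c b (-(3 * a))) := by
      rw [hr, hs]
      generalize hat b c b (-(3 * a)) = u
      generalize hat b c 1 0 = v
      have h1 : (6 * p * g * Y * Z) ^ 2 = (1 + A * l) ^ 2 := by rw [hcong]
      clear_value A g
      ext t
      simp only [Pi.add_apply, Pi.sub_apply, Pi.smul_apply, smul_eq_mul]
      fin_cases t
      · simp only [Fin.zero_eta, Fin.mk_one, Fin.reduceFinMk, Matrix.cons_val,
          Matrix.cons_val_zero, Matrix.cons_val_one]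
        linear_combination (-18 * a * p * Y) * hcong - u 0 * h1
      · simp only [Fin.zero_eta, Fin.mk_one, Fin.reduceFinMk, Matrix.cons_val,
          Matrix.cons_val_zero, Matrix.cons_val_one]
        linear_combination  - u 1 * h1
      · simp only [Fin.zero_eta, Fin.mk_one, Fin.reduceFinMk, Matrix.cons_val,
          Matrix.cons_val_zero, Matrix.cons_val_one]
        linear_combination  - u 2 * h1
    rw [← Matrix.mulVec_mulVec, e, Matrix.mulVec_add, Matrix.mulVec_smul, Matrix.mulVec_smul,
      Matrix.mulVec_mulVec, hSS, Matrix.one_mulVec]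


lemma bil_smul_right (G : Matrix (Fin 3) (Fin 3) ℤ) (s : ℤ) (u v : Fin 3 → ℤ) :
    bil G u (s • v) = s * bil G u v := by
  simp only [bil, Matrix.mulVec_smul, dotProduct_smul, smul_eq_mul]

lemma bil_smul_left (G : Matrix (Fin 3) (Fin 3) ℤ) (s : ℤ) (u v : Fin 3 → ℤ) :
    bil G (s • u) v = s * bil G u v := by
  simp only [bil, smul_dotProduct, smul_eq_mul]

lemma bil_add_right (G : Matrix (Fin 3) (Fin 3) ℤ) (u v w : Fin 3 → ℤ) :
    bil G u (v + w) = bil G u v + bil G u w := by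
  simp only [bil, Matrix.mulVec_add, dotProduct_add]

lemma bil_add_left (G : Matrix (Fin 3) (Fin 3) ℤ) (u v w : Fin 3 → ℤ) :
    bil G (u + v) w = bil G u w + bil G v w := by
  simp only [bil, add_dotProduct]

lemma bil_iso (G g : Matrix (Fin 3) (Fin 3) ℤ) (h : gᵀ * G * g = G) (u v : Fin 3 → ℤ) :
    bil G (g *ᵥ u) (g *ᵥ v) = bil G u v := by
  unfold bil
  nth_rewrite 2 [← h]
  rw [← Matrix.mulVec_mulVec, ← Matrix.mulVec_mulVec, Matrix.dotProduct_mulVec u,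
    Matrix.vecMul_transpose]

lemma P_iso (a b c d x0 x1 ω y0 y1 k : ℤ) :
    bil (GM a b c d)
      ![x0 + (-b ^ 2 * c + 2 * a * c ^ 2 + 3 * a * b * d) * ω, x1 + (b * c - 9 * a * d) * ω,
        -(b ^ 2 - 3 * a * c) * ω]
      ![y0 + (-b ^ 2 * c + 2 * a * c ^ 2 + 3 * a * b * d) * k, y1 + (b * c - 9 * a * d) * k,
        -(b ^ 2 - 3 * a * c) * k] =
    bil (GM a b c d) ![x0, x1, (b ^ 2 - 3 * a * c) * ω] ![y0, y1, (b ^ 2 - 3 * a * c) * k] := by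
  rw [bil_symM, bil_symM]; simp; ring

lemma short_vectors (a b c d p : ℤ) (hp : 0 < p) (hsq : ¬ IsSquare (6 * p))
    (hdet : (GM a b c d).det = -p)
    (hA : IsCoprime (6 * p) (b ^ 2 - 3 * a * c)) (hA0 : b ^ 2 - 3 * a * c ≠ 0) :
    ∃ m₁ m₂ : Fin 3 → ℤ, bil (GM a b c d) m₁ m₁ = 3 ∧ bil (GM a b c d) m₁ m₂ = 1 ∧
      bil (GM a b c d) m₂ m₂ = 1 := by
  obtain ⟨g, hg, κ, r, hκ, hr⟩ := aut_exists a b c d p hp hsq hdet hA hA0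
  have cB := cop_B a b c d p hdet hA
  have c3 : IsCoprime 3 (b ^ 2 - 3 * a * c) := by
    have : (6 : ℤ) * p = 3 * (2 * p) := by ring
    rw [this] at hA
    exact hA.of_mul_left_left
  have c2 : IsCoprime 2 (b ^ 2 - 3 * a * c) := by
    have : (6 : ℤ) * p = 2 * (3 * p) := by ring
    rw [this] at hA
    exact hA.of_mul_left_left
  have hiso := bil_iso (GM a b c d) g hg
  obtain ⟨o, ho⟩ : ∃ o, o = g *ᵥ ![1, 0, 0] := ⟨_, rfl⟩
  obtain ⟨h, hh⟩ : ∃ h, h = g *ᵥ ![-2 * a * c, b, -3 * a] := ⟨_, rfl⟩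
  have q1 : bil (GM a b c d) o o = 3 := by
    rw [ho, hiso, bil_symM]; simp
  have q2 : bil (GM a b c d) o h = b ^ 2 - 3 * a * c := by
    rw [ho, hh, hiso, bil_symM]; simp; ring
  have q3 : bil (GM a b c d) h h = (b ^ 2 - 3 * a * c) ^ 2 := by
    rw [hh, hiso, bil_symM]; simp; ring
  have q4 : bil (GM a b c d) o (g *ᵥ (hat b c b (-(3 * a)))) = 0 := by
    rw [ho, hiso, bil_symM]; simp [hat]; ring
  have h3 : (3 : ℤ) • h = κ • hat b c 1 0 + (b ^ 2 - 3 * a * c) • (r + o) := by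
    rw [smul_add, ← add_assoc, ← hr, ho, hh, ← Matrix.mulVec_smul, ← Matrix.mulVec_smul,
      ← Matrix.mulVec_add]
    congr 1
    ext i; fin_cases i <;> simp [hat] <;> ring
  rw [hr, bil_add_right, bil_smul_right, bil_smul_right] at q4
  have e4 : bil (GM a b c d) o (hat b c 1 0) =
      2 * (b ^ 2 - 3 * a * c) * o 1 + (b * c - 9 * a * d) * o 2 := by
    rw [bil_symM]; simp [hat]; ring
  rw [e4] at q4
  have d1 : (b ^ 2 - 3 * a * c) ∣ o 2 := by
    have : (b ^ 2 - 3 * a * c) ∣ (κ * (b * c - 9 * a * d)) * o 2 :=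
      ⟨-(κ * 2 * o 1) - bil (GM a b c d) o r, by linear_combination q4⟩
    exact (hκ.mul_left cB).symm.dvd_of_dvd_mul_left this
  have f0 := congrFun h3 0
  have f1 := congrFun h3 1
  have f2 := congrFun h3 2
  simp only [hat, Pi.add_apply, Pi.smul_apply, smul_eq_mul, Matrix.cons_val_zero,
    Matrix.cons_val_one, Matrix.cons_val] at f0 f1 f2
  obtain ⟨k, hk⟩ : (b ^ 2 - 3 * a * c) ∣ h 2 :=
    c3.symm.dvd_of_dvd_mul_left ⟨r 2 + o 2, by linear_combination f2⟩
  obtain ⟨j, hj⟩ : (b ^ 2 - 3 * a * c) ∣ h 1 - κ :=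
    c3.symm.dvd_of_dvd_mul_left ⟨r 1 + o 1, by linear_combination f1⟩
  have hh1 : IsCoprime (h 1) (b ^ 2 - 3 * a * c) := by
    have := hκ.add_mul_left_left j
    rwa [← hj, add_sub_cancel] at this
  obtain ⟨t, ht⟩ : ∃ t, 3 * h 0 + b * h 1 - c * h 2 = (b ^ 2 - 3 * a * c) * t :=
    ⟨r 0 + o 0 + b * j - c * k, by linear_combination f0 + b * hj - c * hk⟩
  have q3' : 3 * (b ^ 2 - 3 * a * c) ^ 2 = (3 * h 0 + b * h 1 - c * h 2) ^ 2
      + 2 * ((b ^ 2 - 3 * a * c) * h 1 ^ 2 + (b * c - 9 * a * d) * h 1 * h 2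
      + (c ^ 2 - 3 * b * d) * h 2 ^ 2) := by
    rw [← q3, bil_symM]; ring
  rw [ht, hk] at q3'
  obtain ⟨s1, hs1⟩ : (b ^ 2 - 3 * a * c) ∣ h 1 + (b * c - 9 * a * d) * k := by
    refine (c2.mul_left hh1).symm.dvd_of_dvd_mul_left
      ⟨3 - t ^ 2 - 2 * (c ^ 2 - 3 * b * d) * k ^ 2, ?_⟩
    apply mul_left_cancel₀ hA0
    linear_combination -q3'
  obtain ⟨s0, hs0⟩ : (b ^ 2 - 3 * a * c) ∣
      h 0 + (-b ^ 2 * c + 2 * a * c ^ 2 + 3 * a * b * d) * k := by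
    refine c3.symm.dvd_of_dvd_mul_left ⟨t - b * s1 - c * k, ?_⟩
    linear_combination ht - b * hs1 + c * hk
  obtain ⟨ω, hω⟩ := d1
  have eo : o = ![o 0, o 1, (b ^ 2 - 3 * a * c) * ω] := by
    rw [← hω]; ext i; fin_cases i <;> rfl
  have eh : h = ![h 0, h 1, (b ^ 2 - 3 * a * c) * k] := by
    rw [← hk]; ext i; fin_cases i <;> rfl
  have em : ![h 0 + (-b ^ 2 * c + 2 * a * c ^ 2 + 3 * a * b * d) * k,
      h 1 + (b * c - 9 * a * d) * k, -(b ^ 2 - 3 * a * c) * k]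
      = (b ^ 2 - 3 * a * c) • ![s0, s1, -k] := by
    rw [hs0, hs1]; ext i; fin_cases i <;> simp <;> ring
  rw [eo] at q1 q2
  rw [eh] at q2 q3
  rw [← P_iso] at q1 q2 q3
  rw [em, bil_smul_right] at q2 q3
  rw [bil_smul_left] at q3
  refine ⟨_, ![s0, s1, -k], q1, ?_, ?_⟩
  · apply mul_left_cancel₀ hA0
    rw [q2]; ring
  · apply mul_left_cancel₀ (pow_ne_zero 2 hA0)
    linear_combination q3


lemma bil_comm_symM (a b c d e f : ℤ) (u v : Fin 3 → ℤ) :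
    bil (symM a b c d e f) u v = bil (symM a b c d e f) v u := by
  rw [bil_symM, bil_symM]; ring

lemma bezout3 (w : Fin 3 → ℤ) (h : ∀ k : ℤ, (∀ i, k ∣ w i) → IsUnit k) :
    ∃ z : Fin 3 → ℤ, z 0 * w 0 + z 1 * w 1 + z 2 * w 2 = 1 := by
  have h1 := Int.gcd_eq_gcd_ab (w 0) (w 1)
  have h2 := Int.gcd_eq_gcd_ab (Int.gcd (w 0) (w 1)) (w 2)
  have hu : IsUnit ((Int.gcd (Int.gcd (w 0) (w 1)) (w 2) : ℕ) : ℤ) := by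
    apply h
    intro i
    fin_cases i
    · exact (Int.gcd_dvd_left _ _).trans (Int.gcd_dvd_left _ _)
    · exact (Int.gcd_dvd_left _ _).trans (Int.gcd_dvd_right _ _)
    · exact Int.gcd_dvd_right _ _
  have h3 : ((Int.gcd (Int.gcd (w 0) (w 1)) (w 2) : ℕ) : ℤ) = 1 := by
    rcases Int.isUnit_iff.1 hu with h | h <;> omega
  rw [h3] at h2
  rw [h1] at h2
  set S := Int.gcdA (w 0 * (w 0).gcdA (w 1) + w 1 * (w 0).gcdB (w 1)) (w 2)
  set T := Int.gcdB (w 0 * (w 0).gcdA (w 1) + w 1 * (w 0).gcdB (w 1)) (w 2)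
  refine ⟨![S * (w 0).gcdA (w 1), S * (w 0).gcdB (w 1), T], ?_⟩
  simp
  linear_combination -h2

lemma sq_dvd_two (k : ℤ) (h : k ^ 2 ∣ 2) : IsUnit k := by
  have h1 : k ^ 2 ≤ 2 := Int.le_of_dvd (by norm_num) h
  have h2 : k ≤ 1 := by nlinarith
  have h3 : -1 ≤ k := by nlinarith
  interval_cases k
  · decide
  · norm_num at h
  · decide

/-- completing two short vectors to the standard basis. -/
lemma complete_basis (a b c d e f p : ℤ) (hdet : (symM a b c d e f).det = -p) (hodd : Odd p)
    (m₁ m : Fin 3 → ℤ) (h1 : bil (symM a b c d e f) m₁ m₁ = 3)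
    (h2 : bil (symM a b c d e f) m₁ m = 1) (h3 : bil (symM a b c d e f) m m = 1) :
    ∃ V : Matrix (Fin 3) (Fin 3) ℤ, V.det = 1 ∧
      V * symM a b c d e f * Vᵀ = symM 1 0 0 2 (-1) ((1 - p) / 2) := by
  obtain ⟨n, hn⟩ : ∃ n, n = m₁ + (-1 : ℤ) • m := ⟨_, rfl⟩
  have h2' := bil_comm_symM a b c d e f m m₁
  have n1 : bil (symM a b c d e f) n n = 2 := by
    rw [hn]; simp only [bil_add_left, bil_add_right, bil_smul_left, bil_smul_right]
    linarith
  have n2 : bil (symM a b c d e f) m n = 0 := by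
    rw [hn]; simp only [bil_add_left, bil_add_right, bil_smul_left, bil_smul_right]
    linarith
  obtain ⟨z, hz⟩ := bezout3 ![m 1 * n 2 - m 2 * n 1, m 2 * n 0 - m 0 * n 2, m 0 * n 1 - m 1 * n 0] (by
    intro k hk
    obtain ⟨w0, hw0⟩ := hk 0
    obtain ⟨w1, hw1⟩ := hk 1
    obtain ⟨w2, hw2⟩ := hk 2
    simp at hw0 hw1 hw2
    apply sq_dvd_two
    refine ⟨(d * f - e ^ 2) * w0 ^ 2 + (a * f - c ^ 2) * w1 ^ 2 + (a * d - b ^ 2) * w2 ^ 2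
      + 2 * (c * e - b * f) * w0 * w1 + 2 * (b * e - c * d) * w0 * w2
      + 2 * (b * c - a * e) * w1 * w2, ?_⟩
    have key : bil (symM a b c d e f) m m * bil (symM a b c d e f) n n
        - bil (symM a b c d e f) m n ^ 2 = 
        (d * f - e ^ 2) * (m 1 * n 2 - m 2 * n 1) ^ 2 + (a * f - c ^ 2) * (m 2 * n 0 - m 0 * n 2) ^ 2
         + (a * d - b ^ 2) * (m 0 * n 1 - m 1 * n 0) ^ 2
      + 2 * (c * e - b * f) * (m 1 * n 2 - m 2 * n 1) * (m 2 * n 0 - m 0 * n 2)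
      + 2 * (b * e - c * d) * (m 1 * n 2 - m 2 * n 1) * (m 0 * n 1 - m 1 * n 0)
      + 2 * (b * c - a * e) * (m 2 * n 0 - m 0 * n 2) * (m 0 * n 1 - m 1 * n 0) := by
      simp only [bil_symM]; ring
    rw [hw0, hw1, hw2, h3, n1, n2] at key
    linear_combination key)
  simp at hz
  obtain ⟨z', hz'⟩ : ∃ z', z' = z + (-bil (symM a b c d e f) m z) • m := ⟨_, rfl⟩
  have z1 : bil (symM a b c d e f) m z' = 0 := by
    rw [hz']; simp only [bil_add_right, bil_smul_right]; rw [h3]; ring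
  obtain ⟨β, hβ⟩ : ∃ β, β = bil (symM a b c d e f) n z' := ⟨_, rfl⟩
  have gram : ∀ u v w : Fin 3 → ℤ, ∀ i j : Fin 3,
      (Matrix.of ![u, v, w] * symM a b c d e f * (Matrix.of ![u, v, w])ᵀ) i j
        = bil (symM a b c d e f) (![u, v, w] i) (![u, v, w] j) := by
    intro u v w i j
    rw [Matrix.mul_mul_apply]; rfl
  have gdet : ∀ u v w : Fin 3 → ℤ, (Matrix.of ![u, v, w]).det = 
      w 0 * (u 1 * v 2 - u 2 * v 1) + w 1 * (u 2 * v 0 - u 0 * v 2) 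
        + w 2 * (u 0 * v 1 - u 1 * v 0) := by
    intro u v w
    rw [Matrix.det_fin_three]; simp; ring
  have big : ∀ s : ℤ, ∃ V : Matrix (Fin 3) (Fin 3) ℤ, V.det = 1 ∧
      V * symM a b c d e f * Vᵀ = symM 1 0 0 2 (β + 2 * s)
        (bil (symM a b c d e f) (z' + s • n) (z' + s • n)) := by
    intro s
    refine ⟨Matrix.of ![m, n, z' + s • n], ?_, ?_⟩
    · rw [gdet, hz']; simp only [Pi.add_apply, Pi.smul_apply, smul_eq_mul]
      linear_combination hz
    · have t1 : bil (symM a b c d e f) m (z' + s • n) = 0 := by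
        simp only [bil_add_right, bil_smul_right]; rw [z1, n2]; ring
      have t2 : bil (symM a b c d e f) n (z' + s • n) = β + 2 * s := by
        simp only [bil_add_right, bil_smul_right]; rw [n1, hβ]; ring
      ext i j
      rw [gram]
      fin_cases i <;> fin_cases j
      · exact h3
      · exact n2
      · exact t1
      · exact (bil_comm_symM _ _ _ _ _ _ _ _).trans n2
      · exact n1
      · exact t2
      · exact (bil_comm_symM _ _ _ _ _ _ _ _).trans t1
      · exact (bil_comm_symM _ _ _ _ _ _ _ _).trans t2
      · rfl
  have dets : ∀ s : ℤ, 2 * bil (symM a b c d e f) (z' + s • n) (z' + s • n) - (β + 2 * s) ^ 2 = -p := by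
    intro s
    obtain ⟨V, hV, hV2⟩ := big s
    have := congrArg Matrix.det hV2
    rw [Matrix.det_mul, Matrix.det_mul, Matrix.det_transpose, hV, hdet, symM_det] at this
    linarith
  have hβo : Odd β := by
    have := dets 0
    rw [← Int.not_even_iff_odd]
    rintro ⟨t, ht⟩
    obtain ⟨l, hl⟩ := hodd
    rw [ht, hl] at this
    ring_nf at this
    omega
  obtain ⟨t, ht⟩ := hβo
  obtain ⟨V, hV, hV2⟩ := big (-(t + 1))
  have hs := dets (-(t + 1))
  have e1 : β + 2 * -(t + 1) = -1 := by rw [ht]; ring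
  rw [e1] at hV2 hs
  refine ⟨V, hV, ?_⟩
  rw [hV2]
  congr 1
  generalize bil (symM a b c d e f) (z' + -(t + 1) • n) (z' + -(t + 1) • n) = γ at hs
  omega

lemma core_form (a b c d p : ℤ) (hp : 0 < p) (hodd : Odd p) (hsq : ¬ IsSquare (6 * p))
    (hdet : (GM a b c d).det = -p)
    (hA : IsCoprime (6 * p) (b ^ 2 - 3 * a * c)) (hA0 : b ^ 2 - 3 * a * c ≠ 0) :
    ∃ V : Matrix (Fin 3) (Fin 3) ℤ, V.det = 1 ∧
      V * GM a b c d * Vᵀ = symM 1 0 0 2 (-1) ((1 - p) / 2) := by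
  obtain ⟨m₁, m₂, h1, h2, h3⟩ := short_vectors a b c d p hp hsq hdet hA hA0
  exact complete_basis _ _ _ _ _ _ p hdet hodd m₁ m₂ h1 h2 h3


lemma new_basis {R : Type*} [CommRing R] (β : Basis (Fin 3) ℤ R) (M : Matrix (Fin 3) (Fin 3) ℤ)
    (h : M.det = 1) :
    ∃ γ : Basis (Fin 3) ℤ R, (∀ i, γ i = M i 0 * β 0 + M i 1 * β 1 + M i 2 * β 2) ∧
      Algebra.traceMatrix ℤ γ = M * Algebra.traceMatrix ℤ β * Mᵀ := by
  have hv : IsUnit (β.det ((M.map (algebraMap ℤ R)) *ᵥ β)) := by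
    rw [Basis.det_apply]
    have : β.toMatrix ((M.map (algebraMap ℤ R)) *ᵥ β) = Mᵀ := by
      ext i j
      rw [Basis.toMatrix_apply]
      have : ((M.map (algebraMap ℤ R)) *ᵥ β) j = ∑ k, M j k • β k := by
        simp [Matrix.mulVec, dotProduct, zsmul_eq_mul]
      rw [this, Basis.repr_sum_self]; rfl
    rw [this, Matrix.det_transpose, h]; exact isUnit_one
  obtain ⟨h1, h2⟩ := (Basis.is_basis_iff_det β).2 hv
  refine ⟨Basis.mk h1 h2.ge, ?_, ?_⟩
  · intro i
    rw [Basis.mk_apply]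
    simp [Matrix.mulVec, dotProduct, Fin.sum_univ_three]
  · rw [Basis.coe_mk, Algebra.traceMatrix_of_matrix_mulVec]

lemma unimod_row (c : Fin 3 → ℤ) (hc : ∀ k : ℤ, (∀ i, k ∣ c i) → IsUnit k) :
    ∃ M : Matrix (Fin 3) (Fin 3) ℤ, M.det = 1 ∧ M 0 = c := by
  obtain ⟨d0, d1, h0, h1, hu⟩ := extract_gcd (c 0) (c 1)
  obtain ⟨s, t, hst⟩ := (gcd_isUnit_iff d0 d1).1 hu
  generalize gcd (c 0) (c 1) = g at h0 h1
  have hg : IsCoprime g (c 2) := by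
    rw [← gcd_isUnit_iff]
    apply hc
    intro i
    fin_cases i
    · exact (gcd_dvd_left _ _).trans ⟨_, h0⟩
    · exact (gcd_dvd_left _ _).trans ⟨_, h1⟩
    · exact gcd_dvd_right _ _
  obtain ⟨n, m, hnm⟩ := hg
  refine ⟨Matrix.of ![c, ![-t, s, 0], ![-d0 * m, -d1 * m, n]], ?_, rfl⟩
  rw [Matrix.det_fin_three]
  simp
  rw [h0, h1]
  linear_combination hnm + (g * n + m * c 2) * hst

lemma primitive_one {R : Type*} [CommRing R] (β : Basis (Fin 3) ℤ R) (k : ℤ)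
    (h : ∀ i, k ∣ β.repr 1 i) : IsUnit k := by
  choose y hy using h
  have h1 : (1 : R) = algebraMap ℤ R k * ∑ i, y i • β i := by
    conv_lhs => rw [← β.sum_repr 1]
    rw [Finset.mul_sum]
    refine Finset.sum_congr rfl fun i _ => ?_
    rw [hy i]; simp [zsmul_eq_mul, mul_assoc]
  have : Module.Free ℤ R := Module.Free.of_basis β
  have h2 := congrArg (Algebra.norm ℤ) h1
  rw [map_mul, Algebra.norm_algebraMap, map_one, Module.finrank_eq_card_basis β] at h2
  simp at h2
  have h3 : IsUnit (k ^ 3) := IsUnit.of_mul_eq_one _ h2.symm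
  exact (isUnit_pow_iff (by norm_num)).1 h3

lemma basis_one {R : Type*} [CommRing R] (β : Basis (Fin 3) ℤ R) :
    ∃ γ : Basis (Fin 3) ℤ R, γ 0 = 1 := by
  obtain ⟨M, hM, hM0⟩ := unimod_row (fun i => β.repr 1 i) (primitive_one β)
  obtain ⟨γ, hγ, -⟩ := new_basis β M hM
  refine ⟨γ, ?_⟩
  rw [hγ 0, hM0]
  conv_rhs => rw [← β.sum_repr 1]
  simp [Fin.sum_univ_three, zsmul_eq_mul]

lemma repr_eq {R : Type*} [CommRing R] (β : Basis (Fin 3) ℤ R) (h : β 0 = 1) (x : R) :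
    ∃ r s t : ℤ, x = r + s * β 1 + t * β 2 := by
  refine ⟨β.repr x 0, β.repr x 1, β.repr x 2, ?_⟩
  conv_lhs => rw [← β.sum_repr x]
  simp [Fin.sum_univ_three, zsmul_eq_mul, h]

lemma repr_val {R : Type*} [CommRing R] (β : Basis (Fin 3) ℤ R) (h : β 0 = 1) (r s t : ℤ) :
    ⇑(β.repr (r + s * β 1 + t * β 2)) = ![r, s, t] := by
  have : (r + s * β 1 + t * β 2 : R) = ∑ i, (![r, s, t] i) • β i := by
    simp [Fin.sum_univ_three, zsmul_eq_mul, h]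
  rw [this, Basis.repr_sum_self]

lemma indep {R : Type*} [CommRing R] (β : Basis (Fin 3) ℤ R) (h : β 0 = 1) (r s t r' s' t' : ℤ)
    (e : (r + s * β 1 + t * β 2 : R) = r' + s' * β 1 + t' * β 2) : r = r' ∧ s = s' ∧ t = t' := by
  have := congrArg (fun x => ⇑(β.repr x)) e
  simp only [repr_val β h] at this
  exact ⟨congrFun this 0, congrFun this 1, congrFun this 2⟩

lemma trace_three {R : Type*} [CommRing R] (β : Basis (Fin 3) ℤ R) (x : R) :
    Algebra.trace ℤ R x = β.repr (x * β 0) 0 + β.repr (x * β 1) 1 + β.repr (x * β 2) 2 := by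
  rw [Algebra.trace_eq_matrix_trace β, Matrix.trace]
  simp [Fin.sum_univ_three, Algebra.leftMulMatrix_eq_repr_mul]

lemma trace_lin {R : Type*} [CommRing R] (r s t : ℤ) (x y z : R) :
    Algebra.trace ℤ R (r * x + s * y + t * z) = r * Algebra.trace ℤ R x
      + s * Algebra.trace ℤ R y + t * Algebra.trace ℤ R z := by
  simp only [← zsmul_eq_mul, map_add, map_smul, smul_eq_mul]

/-- Delone-Faddeev normalization. -/
lemma df_normalize {R : Type*} [CommRing R] (β : Basis (Fin 3) ℤ R) (h : β 0 = 1) :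
    ∃ (a b c d k l : ℤ) (γ : Basis (Fin 3) ℤ R), γ 0 = 1 ∧ γ 1 = β 1 + k ∧ γ 2 = β 2 + l ∧
      Algebra.traceMatrix ℤ γ = GM a b c d := by
  obtain ⟨r, s, t, hrst⟩ := repr_eq β h (β 1 * β 2)
  obtain ⟨γ, hγ, -⟩ := new_basis β !![1, 0, 0; -t, 1, 0; -s, 0, 1] (by
    rw [Matrix.det_fin_three]; simp)
  have g0 : γ 0 = 1 := by rw [hγ]; simp [h]
  have g1 : γ 1 = β 1 + ((-t : ℤ) : R) := by rw [hγ]; simp [h]; ring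
  have g2 : γ 2 = β 2 + ((-s : ℤ) : R) := by rw [hγ]; simp [h]; ring
  obtain ⟨e, b, a', he⟩ := repr_eq γ g0 (γ 1 * γ 1)
  obtain ⟨f, d, c', hf⟩ := repr_eq γ g0 (γ 2 * γ 2)
  obtain ⟨a, rfl⟩ : ∃ a, a' = -a := ⟨-a', by ring⟩
  obtain ⟨c, rfl⟩ : ∃ c, c' = -c := ⟨-c', by ring⟩
  have hn : γ 1 * γ 2 = ((r + s * t : ℤ) : R) := by
    rw [g1, g2]; push_cast; linear_combination hrst
  generalize r + s * t = n at hn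
  obtain ⟨i1, i2, i3⟩ := indep γ g0 0 n 0 (b * n - a * f) (-(a * d)) (e + a * c) (by
    push_cast at he hf ⊢
    linear_combination (-γ 1) * hn + γ 2 * he + b * hn - a * hf)
  obtain ⟨j1, j2, j3⟩ := indep γ g0 0 0 n (d * e - c * n) (f + d * b) (-(a * d)) (by
    push_cast at he hf ⊢
    linear_combination (-γ 2) * hn + γ 1 * hf + d * he - c * hn)
  have he' : e = -(a * c) := by linarith
  have hf' : f = -(b * d) := by linarith
  subst he' hf' i2
  have t1 : Algebra.trace ℤ R 1 = 3 := by
    have : Module.Free ℤ R := Module.Free.of_basis γ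
    have := Algebra.trace_algebraMap (S := R) (1 : ℤ)
    rw [map_one, Module.finrank_eq_card_basis γ] at this
    simpa using this
  have z1 : γ 1 * γ 0 = ((0 : ℤ) : R) + ((1 : ℤ) : R) * γ 1 + ((0 : ℤ) : R) * γ 2 := by
    rw [g0]; push_cast; ring
  have z2 : γ 2 * γ 0 = ((0 : ℤ) : R) + ((0 : ℤ) : R) * γ 1 + ((1 : ℤ) : R) * γ 2 := by
    rw [g0]; push_cast; ring
  have z3 : γ 1 * γ 2 = ((-(a * d) : ℤ) : R) + ((0 : ℤ) : R) * γ 1 + ((0 : ℤ) : R) * γ 2 := by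
    rw [hn]; push_cast; ring
  have z4 : γ 2 * γ 1 = ((-(a * d) : ℤ) : R) + ((0 : ℤ) : R) * γ 1 + ((0 : ℤ) : R) * γ 2 := by
    rw [mul_comm, z3]
  have tω : Algebra.trace ℤ R (γ 1) = b := by
    rw [trace_three γ, z1, z3, he, repr_val γ g0, repr_val γ g0, repr_val γ g0]; simp
  have tθ : Algebra.trace ℤ R (γ 2) = -c := by
    rw [trace_three γ, z2, z4, hf, repr_val γ g0, repr_val γ g0, repr_val γ g0]; simp
  have tl : ∀ u v w : ℤ, Algebra.trace ℤ R (u + v * γ 1 + w * γ 2) = 3 * u + b * v - c * w := by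
    intro u v w
    have := trace_lin u v w 1 (γ 1) (γ 2)
    rw [mul_one] at this
    rw [this, t1, tω, tθ]; ring
  refine ⟨a, b, c, d, -t, -s, γ, g0, g1, g2, ?_⟩
  ext i j
  rw [Algebra.traceMatrix_apply, Algebra.traceForm_apply]
  fin_cases i <;> fin_cases j
  · simp [g0, t1, symM]
  · simp [g0, tω, symM]
  · simp [g0, tθ, symM]
  · simp [g0, tω, symM]
  · simp only [Fin.mk_one, he, tl]; simp [symM]; ring
  · simp only [Fin.mk_one, Fin.reduceFinMk, z3, tl]; simp [symM]; ring
  · simp [g0, tθ, symM]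
  · simp only [Fin.mk_one, Fin.reduceFinMk, z4, tl]; simp [symM]; ring
  · simp only [Fin.reduceFinMk, hf, tl]; simp [symM]; ring


/-- value of a binary quadratic form. -/
def Hf (A B C x y : ℤ) : ℤ := A * x ^ 2 + B * x * y + C * y ^ 2

lemma hf_local (A B C ℓ : ℤ) (hℓ : Prime ℓ) (h : ¬ (ℓ ∣ A ∧ ℓ ∣ B ∧ ℓ ∣ C)) :
    ∃ x y : ℤ, IsCoprime ℓ (Hf A B C x y) := by
  by_contra hc
  push Not at hc
  have h' : ∀ x y, ℓ ∣ Hf A B C x y := by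
    intro x y
    by_contra hd
    exact hc x y (hℓ.coprime_iff_not_dvd.2 hd)
  have h1 := h' 1 0
  have h2 := h' 0 1
  have h3 := h' 1 1
  simp [Hf] at h1 h2 h3
  refine h ⟨h1, ?_, h2⟩
  have := dvd_sub (dvd_sub h3 h1) h2
  have e : A + B + C - A - C = B := by ring
  rwa [e] at this

lemma hf_crt (A B C n₁ n₂ : ℤ) (hn : IsCoprime n₁ n₂)
    (h1 : ∃ x y : ℤ, IsCoprime n₁ (Hf A B C x y)) (h2 : ∃ x y : ℤ, IsCoprime n₂ (Hf A B C x y)) :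
    ∃ x y : ℤ, IsCoprime (n₁ * n₂) (Hf A B C x y) := by
  obtain ⟨x1, y1, h1⟩ := h1
  obtain ⟨x2, y2, h2⟩ := h2
  obtain ⟨u, v, huv⟩ := hn
  have gen : ∀ x y m s t : ℤ, Hf A B C (x + m * s) (y + m * t) = Hf A B C x y
      + m * (A * (2 * x * s + m * s ^ 2) + B * (x * t + s * y + m * s * t)
        + C * (2 * y * t + m * t ^ 2)) := by
    intros; unfold Hf; ring
  refine ⟨x1 + n₁ * (u * (x2 - x1)), y1 + n₁ * (u * (y2 - y1)), IsCoprime.mul_left ?_ ?_⟩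
  · rw [gen]
    exact h1.add_mul_left_right _
  · have ex : x1 + n₁ * (u * (x2 - x1)) = x2 + n₂ * (v * (x1 - x2)) := by
      linear_combination (x2 - x1) * huv
    have ey : y1 + n₁ * (u * (y2 - y1)) = y2 + n₂ * (v * (y1 - y2)) := by
      linear_combination (y2 - y1) * huv
    rw [ex, ey, gen]
    exact h2.add_mul_left_right _

lemma hf_choice (A B C : ℤ) (p : ℕ) (hp : p.Prime) (hp2 : p ≠ 2) (hp3 : p ≠ 3)
    (h : B ^ 2 - 4 * A * C = 3 * p) :
    ∃ x y : ℤ, IsCoprime x y ∧ IsCoprime (6 * (p : ℤ)) (Hf A B C x y) := by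
  have hpp : Prime (p : ℤ) := Nat.prime_iff_prime_int.1 hp
  have sq : ∀ ℓ : ℤ, (ℓ ∣ A ∧ ℓ ∣ B ∧ ℓ ∣ C) → ℓ ^ 2 ∣ 3 * p := by
    rintro ℓ ⟨⟨r, hr⟩, ⟨s, hs⟩, ⟨t, ht⟩⟩
    exact ⟨s ^ 2 - 4 * r * t, by rw [← h, hr, hs, ht]; ring⟩
  have c2p : IsCoprime (2 : ℤ) p := by
    have := (Nat.coprime_primes Nat.prime_two hp).2 (Ne.symm hp2)
    exact_mod_cast Nat.isCoprime_iff_coprime.2 this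
  have c3p : IsCoprime (3 : ℤ) p := by
    have := (Nat.coprime_primes Nat.prime_three hp).2 (Ne.symm hp3)
    exact_mod_cast Nat.isCoprime_iff_coprime.2 this
  have l2 : ¬ ((2 : ℤ) ∣ A ∧ (2 : ℤ) ∣ B ∧ (2 : ℤ) ∣ C) := by
    intro hd
    have h1 := (dvd_pow_self (2 : ℤ) two_ne_zero).trans (sq 2 hd)
    have h2 := c2p.dvd_of_dvd_mul_right h1
    norm_num at h2
  have l3 : ¬ ((3 : ℤ) ∣ A ∧ (3 : ℤ) ∣ B ∧ (3 : ℤ) ∣ C) := by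
    intro hd
    have h1 := sq 3 hd
    have h2 := (c3p.pow_left (m := 2)).dvd_of_dvd_mul_right h1
    norm_num at h2
  have lp : ¬ ((p : ℤ) ∣ A ∧ (p : ℤ) ∣ B ∧ (p : ℤ) ∣ C) := by
    intro hd
    have h1 := sq p hd
    rw [pow_two] at h1
    have h2 := Int.dvd_of_mul_dvd_mul_right hpp.ne_zero h1
    have h3 : p ∣ 3 := by exact_mod_cast h2
    exact hp3 ((Nat.prime_dvd_prime_iff_eq hp Nat.prime_three).1 h3)
  obtain ⟨x, y, hxy⟩ := hf_crt A B C (2 * 3) p (c2p.mul_left c3p)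
    (hf_crt A B C 2 3 (by norm_num) (hf_local A B C 2 Int.prime_two l2)
      (hf_local A B C 3 Int.prime_three l3)) (hf_local A B C p hpp lp)
  obtain ⟨x', y', hx, hy, hu⟩ := extract_gcd x y
  refine ⟨x', y', (gcd_isUnit_iff _ _).1 hu, ?_⟩
  generalize gcd x y = g at hx hy
  have e : Hf A B C x y = g ^ 2 * Hf A B C x' y' := by rw [hx, hy]; unfold Hf; ring
  rw [e] at hxy
  have := hxy.of_mul_right_right
  norm_num at this
  exact this

lemma trace_H {R : Type*} [CommRing R] (β : Basis (Fin 3) ℤ R) (h : β 0 = 1) (a b c d : ℤ)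
    (hβ : Algebra.traceMatrix ℤ β = GM a b c d) (r s t : ℤ) :
    3 * Algebra.trace ℤ R ((r + s * β 1 + t * β 2) * (r + s * β 1 + t * β 2))
      - Algebra.trace ℤ R (r + s * β 1 + t * β 2) ^ 2 =
      2 * Hf (b ^ 2 - 3 * a * c) (b * c - 9 * a * d) (c ^ 2 - 3 * b * d) s t := by
  have ent : ∀ i j, Algebra.trace ℤ R (β i * β j) = GM a b c d i j := by
    intro i j
    rw [← hβ, Algebra.traceMatrix_apply, Algebra.traceForm_apply]
  have t0 : Algebra.trace ℤ R 1 = 3 := by have := ent 0 0; simpa [h, symM] using this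
  have t1 : Algebra.trace ℤ R (β 1) = b := by have := ent 0 1; simpa [h, symM] using this
  have t2 : Algebra.trace ℤ R (β 2) = -c := by have := ent 0 2; simpa [h, symM] using this
  have t11 : Algebra.trace ℤ R (β 1 * β 1) = b ^ 2 - 2 * a * c := by
    have := ent 1 1; simpa [symM] using this
  have t12 : Algebra.trace ℤ R (β 1 * β 2) = -(3 * a * d) := by
    have := ent 1 2; simpa [symM] using this
  have t22 : Algebra.trace ℤ R (β 2 * β 2) = c ^ 2 - 2 * b * d := by
    have := ent 2 2; simpa [symM] using this
  have e1 : Algebra.trace ℤ R (r + s * β 1 + t * β 2) = 3 * r + b * s - c * t := by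
    have := trace_lin r s t 1 (β 1) (β 2)
    rw [mul_one] at this
    rw [this, t0, t1, t2]; ring
  have e2 : ((r : R) + s * β 1 + t * β 2) * (r + s * β 1 + t * β 2) =
      ((1 : ℤ) : R) * (((r ^ 2 : ℤ) : R) * 1 + ((2 * r * s : ℤ) : R) * β 1 + ((2 * r * t : ℤ) : R) * β 2)
      + ((1 : ℤ) : R) * (((s ^ 2 : ℤ) : R) * (β 1 * β 1) + ((2 * s * t : ℤ) : R) * (β 1 * β 2)
        + ((t ^ 2 : ℤ) : R) * (β 2 * β 2)) + ((0 : ℤ) : R) * 1 := by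
    push_cast; ring
  rw [e1, e2, trace_lin, trace_lin, trace_lin, t0, t1, t2, t11, t12, t22]
  unfold Hf; ring

lemma disc_bound (K : Type*) [Field K] [NumberField K] (hK : finrank ℚ K = 3) (p : ℕ)
    (hd : NumberField.discr K = -(p : ℤ)) : p ≠ 3 := by
  rintro rfl
  have := NumberField.abs_discr_ge (K := K) (by omega)
  rw [hd, hK] at this
  have hpi := Real.pi_gt_three
  have h2 : (9 / 4 : ℝ) ^ 3 ≤ (3 * Real.pi / 4) ^ 3 := by
    apply pow_le_pow_left₀ (by norm_num); linarith
  norm_num at this h2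
  linarith

lemma standard_basis (K : Type*) [Field K] [NumberField K] (hK : finrank ℚ K = 3)
    (p : ℕ) (hp : p.Prime) (hd : NumberField.discr K = -(p : ℤ)) :
    ∃ γ : Basis (Fin 3) ℤ (𝓞 K),
      Algebra.traceMatrix ℤ γ = symM 1 0 0 2 (-1) ((1 - (p : ℤ)) / 2) := by
  have hp3 := disc_bound K hK p hd
  have hfr : finrank ℤ (𝓞 K) = 3 := by rw [NumberField.RingOfIntegers.rank, hK]
  obtain ⟨β, hβ⟩ := basis_one (Module.finBasisOfFinrankEq ℤ (𝓞 K) hfr)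
  obtain ⟨a, b, c, d, -, -, γ, g0, -, -, hγ⟩ := df_normalize β hβ
  have hdisc : ∀ δ : Basis (Fin 3) ℤ (𝓞 K), (Algebra.traceMatrix ℤ δ).det = -(p : ℤ) := by
    intro δ
    rw [← hd, ← NumberField.discr_eq_discr K δ, Algebra.discr_def]
  have hdet := hdisc γ
  rw [hγ, GM_det] at hdet
  have hH : (b * c - 9 * a * d) ^ 2 - 4 * (b ^ 2 - 3 * a * c) * (c ^ 2 - 3 * b * d) = 3 * p := by
    linear_combination -3 * hdet
  have hp2 : p ≠ 2 := by
    rintro rfl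
    generalize b * c - 9 * a * d = B at hH
    generalize b ^ 2 - 3 * a * c = A at hH
    generalize c ^ 2 - 3 * b * d = C at hH
    rcases Int.even_or_odd B with ⟨t, ht⟩ | ⟨t, ht⟩
    · rw [ht] at hH; ring_nf at hH; omega
    · rw [ht] at hH; ring_nf at hH; omega
  obtain ⟨x, y, ⟨v, u, huv⟩, hco⟩ := hf_choice _ _ _ p hp hp2 hp3 hH
  obtain ⟨δ, hδ, -⟩ := new_basis γ !![1, 0, 0; 0, x, y; 0, -u, v] (by
    rw [Matrix.det_fin_three]; simp; linear_combination huv)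
  have d0 : δ 0 = 1 := by rw [hδ]; simp [g0]
  have d1 : δ 1 = x * γ 1 + y * γ 2 := by rw [hδ]; simp
  obtain ⟨a', b', c', d', k, -, ε, e0, e1, -, hε⟩ := df_normalize δ d0
  have hA : b' ^ 2 - 3 * a' * c' =
      Hf (b ^ 2 - 3 * a * c) (b * c - 9 * a * d) (c ^ 2 - 3 * b * d) x y := by
    have s1 := trace_H γ g0 a b c d hγ k x y
    have s2 := trace_H ε e0 a' b' c' d' hε 0 1 0
    have : (((0 : ℤ) : 𝓞 K) + ((1 : ℤ) : 𝓞 K) * ε 1 + ((0 : ℤ) : 𝓞 K) * ε 2) = k + x * γ 1 + y * γ 2 := by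
      rw [e1, d1]; push_cast; ring
    rw [this, s1] at s2
    simp only [Hf] at s2 ⊢
    linarith
  rw [← hA] at hco
  have hpos : (0 : ℤ) < p := by exact_mod_cast hp.pos
  have hodd : Odd (p : ℤ) := by exact_mod_cast hp.odd_of_ne_two hp2
  have hsq : ¬ IsSquare (6 * (p : ℤ)) := by
    rintro ⟨r, hr⟩
    have hpp : Prime (p : ℤ) := Nat.prime_iff_prime_int.1 hp
    have h1 : (p : ℤ) ∣ r := by
      have : (p : ℤ) ∣ r * r := ⟨6, by linarith⟩
      rcases hpp.dvd_or_dvd this with h | h <;> exact h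
    obtain ⟨t, ht⟩ := h1
    have h2 : (p : ℤ) ∣ 6 := by
      refine ⟨t * t, ?_⟩
      apply mul_right_cancel₀ hpp.ne_zero
      rw [hr, ht]; ring
    have h3 : p ∣ 2 * 3 := by exact_mod_cast h2
    rcases (Nat.Prime.dvd_mul hp).1 h3 with h | h
    · exact hp2 ((Nat.prime_dvd_prime_iff_eq hp Nat.prime_two).1 h)
    · exact hp3 ((Nat.prime_dvd_prime_iff_eq hp Nat.prime_three).1 h)
  have hA0 : b' ^ 2 - 3 * a' * c' ≠ 0 := by
    intro h0
    rw [h0, isCoprime_zero_right, Int.isUnit_iff] at hco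
    omega
  have hdet' := hdisc ε
  rw [hε] at hdet'
  obtain ⟨V, hV, hV2⟩ := core_form a' b' c' d' p hpos hodd hsq hdet' hco hA0
  obtain ⟨ζ, -, hζ⟩ := new_basis ε V hV
  exact ⟨ζ, by rw [hζ, hε, hV2]⟩

end Helpers

/-- Any two cubic fields with the same prime discriminant `-p` have equivalent
integral trace forms: the integral trace form of a cubic field of discriminant `-p` is
determined up to equivalence by `p`. -/
theorem statement_9 (K L : Type*) [Field K] [NumberField K] [Field L] [NumberField L]
    (hK : finrank ℚ K = 3) (hL : finrank ℚ L = 3)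
    (p : ℕ) (hp : p.Prime)
    (hdK : NumberField.discr K = -(p : ℤ)) (hdL : NumberField.discr L = -(p : ℤ)) :
    IntTraceEquiv K L := by
  obtain ⟨β, hβ⟩ := standard_basis K hK p hp hdK
  obtain ⟨γ, hγ⟩ := standard_basis L hL p hp hdL
  refine ⟨β.equiv γ (Equiv.refl _), ?_⟩
  have key : (Algebra.traceForm ℤ (𝓞 L)).compl₁₂ (β.equiv γ (Equiv.refl _)).toLinearMap
      (β.equiv γ (Equiv.refl _)).toLinearMap = Algebra.traceForm ℤ (𝓞 K) := by
    refine LinearMap.BilinForm.ext_basis β fun i j => ?_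
    simp only [LinearMap.compl₁₂_apply, LinearEquiv.coe_coe, Basis.equiv_apply, Equiv.refl_apply]
    rw [← Algebra.traceMatrix_apply, ← Algebra.traceMatrix_apply, hβ, hγ]
  intro x y
  rw [Algebra.intTrace_eq_trace, Algebra.intTrace_eq_trace]
  exact LinearMap.congr_fun (LinearMap.congr_fun key x) y
end

section
/- Let K and L be arithmetically equivalent number fields (ζ_K = ζ_L) of degree less than 7. Then K and L are isomorphic. -/
open NumberField Module

section GroupPart

open MulAction Finset

variable {G X Y : Type*} [Group G] [Finite G] [MulAction G X] [MulAction G Y] [Finite X] [Finite Y]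

lemma gt_orbits (h : ∀ g : G, Nat.card (fixedBy X g) = Nat.card (fixedBy Y g)) (U : Subgroup G) :
    Nat.card (orbitRel.Quotient U X) = Nat.card (orbitRel.Quotient U Y) := by
  classical
  have := Fintype.ofFinite G
  have := Fintype.ofFinite U
  have := Fintype.ofFinite X
  have := Fintype.ofFinite Y
  have := Fintype.ofFinite (orbitRel.Quotient U X)
  have := Fintype.ofFinite (orbitRel.Quotient U Y)
  have h1 := sum_card_fixedBy_eq_card_orbits_mul_card_group U X
  have h2 := sum_card_fixedBy_eq_card_orbits_mul_card_group U Y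
  have h3 : (∑ g : U, Fintype.card (fixedBy X g)) = ∑ g : U, Fintype.card (fixedBy Y g) := by
    refine Finset.sum_congr rfl fun g _ => ?_
    have := h g
    rw [Nat.card_eq_fintype_card, Nat.card_eq_fintype_card] at this
    convert this <;> rfl
  rw [h1, h2] at h3
  simpa using Nat.eq_of_mul_eq_mul_right Fintype.card_pos h3

lemma gt_sum_orbits (U : Subgroup G) [Fintype (orbitRel.Quotient U Y)] :
    ∑ q : orbitRel.Quotient U Y, Nat.card q.orbit = Nat.card Y := by
  rw [Nat.card_congr (selfEquivSigmaOrbits' U Y), Nat.card_sigma]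

/-- If `g` preserves all the orbits of `H` on `Y` then it preserves all the orbits on `X`. -/
lemma gt_preserve (h : ∀ g : G, Nat.card (fixedBy X g) = Nat.card (fixedBy Y g)) (H : Subgroup G)
    (g : G) (hg : ∀ y : Y, g • y ∈ orbit H y) (x : X) : g • x ∈ orbit H x := by
  classical
  let N : Subgroup G :=
    { carrier := {g | ∀ y : Y, g • y ∈ orbit H y}
      one_mem' := fun y => by simp
      mul_mem' := by
        intro a b ha hb y
        have h1 := ha (b • y)
        rw [orbit_eq_iff.mpr (hb y), smul_smul] at h1
        exact h1
      inv_mem' := by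
        intro a ha y
        have h1 := ha (a⁻¹ • y)
        rw [smul_inv_smul] at h1
        exact mem_orbit_symm.mp h1 }
  have hHN : H ≤ N := fun a ha y => ⟨⟨a, ha⟩, rfl⟩
  have hgN : g ∈ N := hg
  have hY : orbitRel N Y = orbitRel H Y := by
    ext a b
    rw [orbitRel_apply, orbitRel_apply]
    constructor
    · rintro ⟨n, rfl⟩
      exact n.2 b
    · rintro ⟨n, rfl⟩
      exact ⟨⟨n.1, hHN n.2⟩, rfl⟩
  have hc : Nat.card (orbitRel.Quotient H X) = Nat.card (orbitRel.Quotient N X) := by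
    rw [gt_orbits h H, gt_orbits h N]
    unfold orbitRel.Quotient
    rw [hY]
  let f : orbitRel.Quotient H X → orbitRel.Quotient N X :=
    Quotient.map' id (by
      rintro a b ⟨n, rfl⟩
      exact ⟨⟨n.1, hHN n.2⟩, rfl⟩)
  have hf : Function.Surjective f := by
    intro q
    induction q using Quotient.inductionOn'
    exact ⟨Quotient.mk'' _, rfl⟩
  have hb := (Nat.bijective_iff_surjective_and_card f).mpr ⟨hf, hc⟩
  have : (Quotient.mk'' (g • x) : orbitRel.Quotient H X) = Quotient.mk'' x := by
    apply hb.1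
    exact Quotient.sound' ⟨⟨g, hgN⟩, rfl⟩
  exact Quotient.exact' this

/-- The set of `y` in relation with `x` for the orbital of `(x0, y0)`. -/
noncomputable def gtM (G : Type*) {X Y : Type*} [Group G] [MulAction G X] [MulAction G Y]
    [Fintype Y] (x0 : X) (y0 : Y) (x : X) : Finset Y :=
  open Classical in univ.filter (fun y => ∃ g : G, g • x0 = x ∧ g • y0 = y)

lemma gtM_mem [Fintype Y] {x0 : X} {y0 : Y} {x : X} {y : Y} :
    y ∈ gtM G x0 y0 x ↔ ∃ g : G, g • x0 = x ∧ g • y0 = y := by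
  simp [gtM]

lemma gtM_smul [Fintype Y] {x0 : X} {y0 : Y} {x : X} {y : Y} (g : G) :
    g • y ∈ gtM G x0 y0 (g • x) ↔ y ∈ gtM G x0 y0 x := by
  rw [gtM_mem, gtM_mem]
  constructor
  · rintro ⟨k, h1, h2⟩
    exact ⟨g⁻¹ * k, by rw [mul_smul, h1, inv_smul_smul], by rw [mul_smul, h2, inv_smul_smul]⟩
  · rintro ⟨k, h1, h2⟩
    exact ⟨g * k, by rw [mul_smul, h1], by rw [mul_smul, h2]⟩

lemma gtM_card [Fintype Y] {x0 : X} {y0 : Y} (x : X) (g : G) :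
    (gtM G x0 y0 (g • x)).card = (gtM G x0 y0 x).card := by
  symm
  refine Finset.card_bij (fun y _ => g • y) (fun y hy => (gtM_smul g).mpr hy)
    (fun a _ b _ hab => smul_left_cancel g hab) ?_
  intro b hb
  refine ⟨g⁻¹ • b, ?_, smul_inv_smul _ _⟩
  rw [← gtM_smul g, smul_inv_smul]
  exact hb

lemma gtM_inter [Fintype Y] [DecidableEq Y] {x0 : X} {y0 : Y} (x : X) (g : G) (hg : g • x0 = x0) :
    (gtM G x0 y0 x0 ∩ gtM G x0 y0 (g • x)).card = (gtM G x0 y0 x0 ∩ gtM G x0 y0 x).card := by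
  have key : ∀ y, g • y ∈ gtM G x0 y0 x0 ↔ y ∈ gtM G x0 y0 x0 := by
    intro y
    have := gtM_smul (x0 := x0) (y0 := y0) (x := x0) (y := y) g
    rwa [hg] at this
  symm
  refine Finset.card_bij (fun y _ => g • y) ?_
    (fun a _ b _ hab => smul_left_cancel g hab) ?_
  · intro y hy
    rw [mem_inter] at hy ⊢
    exact ⟨(key y).mpr hy.1, (gtM_smul g).mpr hy.2⟩
  · intro b hb
    refine ⟨g⁻¹ • b, ?_, smul_inv_smul _ _⟩
    rw [mem_inter] at hb ⊢
    refine ⟨?_, ?_⟩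
    · rw [← key, smul_inv_smul]
      exact hb.1
    · rw [← gtM_smul g, smul_inv_smul]
      exact hb.2

lemma gtM_sum [Fintype X] [Fintype Y] [DecidableEq Y] [IsPretransitive G X] [IsPretransitive G Y]
    (hc : Fintype.card X = Fintype.card Y) (x0 : X) (y0 : Y) :
    ∑ x : X, (gtM G x0 y0 x0 ∩ gtM G x0 y0 x).card = (gtM G x0 y0 x0).card ^ 2 := by
  classical
  set a := (gtM G x0 y0 x0).card with ha
  let col : Y → ℕ := fun y => (univ.filter (fun x : X => y ∈ gtM G x0 y0 x)).card
  have hrow : ∀ x, (gtM G x0 y0 x).card = a := by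
    intro x
    obtain ⟨g, rfl⟩ := exists_smul_eq G x0 x
    exact gtM_card _ _
  have hcol : ∀ y, col y = col y0 := by
    intro y
    obtain ⟨g, rfl⟩ := exists_smul_eq G y0 y
    symm
    refine Finset.card_bij (fun x _ => g • x) ?_ (fun a _ b _ hab => smul_left_cancel g hab) ?_
    · intro x hx
      rw [mem_filter] at hx ⊢
      exact ⟨mem_univ _, (gtM_smul g).mpr hx.2⟩
    · intro b hb
      refine ⟨g⁻¹ • b, ?_, smul_inv_smul _ _⟩
      rw [mem_filter] at hb ⊢
      rw [← gtM_smul g, smul_inv_smul]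
      exact ⟨mem_univ _, hb.2⟩
  have hdc : ∀ T : Finset Y, ∑ x : X, (T ∩ gtM G x0 y0 x).card = ∑ y ∈ T, col y := by
    intro T
    have h1 : ∀ x, (T ∩ gtM G x0 y0 x).card = ∑ y ∈ T, if y ∈ gtM G x0 y0 x then 1 else 0 := by
      intro x
      rw [← Finset.card_filter]
      congr 1
    simp_rw [h1]
    rw [Finset.sum_comm]
    refine Finset.sum_congr rfl fun y _ => ?_
    rw [← Finset.card_filter]
  have hca : col y0 = a := by
    have h1 := hdc univ
    simp only [univ_inter, hrow, hcol, sum_const, smul_eq_mul, card_univ] at h1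
    rw [hc] at h1
    have : 0 < Fintype.card Y := Fintype.card_pos_iff.mpr ⟨y0⟩
    exact (Nat.eq_of_mul_eq_mul_left this h1).symm
  rw [hdc]
  simp only [hcol, hca, sum_const, smul_eq_mul]
  rw [← ha, sq]

lemma gtM_orbit [Fintype Y] (x0 : X) (y0 : Y) :
    (gtM G x0 y0 x0 : Set Y) = orbit (stabilizer G x0) y0 := by
  ext y
  rw [mem_coe, gtM_mem]
  constructor
  · rintro ⟨g, h1, h2⟩
    exact ⟨⟨g, h1⟩, h2⟩
  · rintro ⟨g, h2⟩
    exact ⟨g.1, g.2, h2⟩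

lemma gtM_orbit_card [Fintype Y] (x0 : X) (y0 : Y) :
    (gtM G x0 y0 x0).card = Nat.card (orbit (stabilizer G x0) y0) := by
  rw [← gtM_orbit, Nat.card_coe_set_eq, Set.ncard_coe_finset]


/-- The group theoretic heart: transitive `G`-sets of size at most `6` with the same permutation
character are isomorphic. -/
theorem gt_main [IsPretransitive G X] [IsPretransitive G Y] (hn : Nat.card X ≤ 6)
    (h : ∀ g : G, Nat.card (fixedBy X g) = Nat.card (fixedBy Y g)) (x0 : X) :
    ∃ y : Y, ∀ g : G, g • x0 = x0 → g • y = y := by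
  classical
  have := Fintype.ofFinite X
  have := Fintype.ofFinite Y
  have hcard : Nat.card X = Nat.card Y := by
    have := h 1
    simpa [fixedBy] using this
  have hcardF : Fintype.card X = Fintype.card Y := by
    simpa using hcard
  set H := stabilizer G x0 with hH
  have := Fintype.ofFinite (orbitRel.Quotient H X)
  have := Fintype.ofFinite (orbitRel.Quotient H Y)
  by_contra! hcon
  have hsz : ∀ y : Y, 2 ≤ Nat.card (orbit H y) := by
    intro y
    obtain ⟨g, hg, hy⟩ := hcon y
    have : Nontrivial (orbit H y) := by
      refine ⟨⟨y, mem_orbit_self y⟩, ⟨g • y, ⟨⟨g, hg⟩, rfl⟩⟩, ?_⟩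
      intro h
      exact hy (congrArg Subtype.val h).symm
    exact Finite.one_lt_card
  have hsq : ∀ q : orbitRel.Quotient H Y, 2 ≤ Nat.card q.orbit := by
    intro q
    induction q using Quotient.inductionOn' with
    | h y => exact hsz y
  have hsX : Nat.card (orbit H x0) = 1 := by
    have : orbit H x0 = {x0} := by
      ext z
      constructor
      · rintro ⟨g, rfl⟩
        exact g.2
      · rintro rfl
        exact mem_orbit_self _
    rw [this]
    simp
  have hk := gt_orbits h H
  have hsumX := gt_sum_orbits (Y := X) H
  have hsumY := gt_sum_orbits (Y := Y) H
  rw [Nat.card_eq_fintype_card, Nat.card_eq_fintype_card] at hk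
  set k := Fintype.card (orbitRel.Quotient H Y) with hkdef
  have hkn : 2 * k ≤ Nat.card Y := by
    rw [← hsumY]
    have := Finset.card_nsmul_le_sum (univ : Finset (orbitRel.Quotient H Y)) _ 2 (fun q _ => hsq q)
    rw [smul_eq_mul, card_univ] at this
    omega
  have hk3 : k ≤ 3 := by omega
  have hk0 : 0 < k := by
    rw [← hk]
    exact Fintype.card_pos_iff.mpr ⟨Quotient.mk'' x0⟩
  let q0 : orbitRel.Quotient H X := Quotient.mk'' x0
  have hq0 : Nat.card q0.orbit = 1 := hsX
  rw [← Finset.add_sum_erase _ _ (mem_univ q0), hq0] at hsumX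
  have hce : (univ.erase q0).card = k - 1 := by
    rw [card_erase_of_mem (mem_univ _), card_univ, hk]
  -- two points outside of x0 in the same class have the same intersection number
  have hsame : ∀ (y0 : Y) (x x' : X), x ∈ orbit H x' →
      (gtM G x0 y0 x0 ∩ gtM G x0 y0 x).card = (gtM G x0 y0 x0 ∩ gtM G x0 y0 x').card := by
    rintro y0 x x' ⟨g, rfl⟩
    exact gtM_inter x' g.1 g.2
  interval_cases k
  · rw [Finset.card_eq_zero.mp hce, Finset.sum_empty] at hsumX
    omega
  · obtain ⟨q1, hq1⟩ := Finset.card_eq_one.mp hce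
    -- a small orbit on Y
    obtain ⟨y0, hy0⟩ : ∃ y0 : Y, 2 * Nat.card (orbit H y0) ≤ Nat.card Y := by
      by_contra! hbig
      have := Finset.card_nsmul_le_sum (univ : Finset (orbitRel.Quotient H Y))
        (fun q => 2 * Nat.card q.orbit) (Nat.card Y + 1) (fun q _ => by
          induction q using Quotient.inductionOn' with
          | h y => exact hbig y)
      rw [smul_eq_mul, card_univ, ← Finset.mul_sum, hsumY, ← hkdef] at this
      omega
    have hy2 := hsz y0
    induction q1 using Quotient.inductionOn' with
    | h x1 =>
    have hmem : ∀ x, x ≠ x0 → x ∈ orbit H x1 := by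
      intro x hx
      have : (Quotient.mk'' x : orbitRel.Quotient H X) ∈ univ.erase q0 := by
        refine mem_erase.mpr ⟨fun he => ?_, mem_univ _⟩
        obtain ⟨g, hg⟩ := Quotient.exact' he
        apply hx
        rw [← hg]
        exact g.2
      rw [hq1, mem_singleton] at this
      exact Quotient.exact' this
    have hs := gtM_sum (G := G) hcardF x0 y0
    rw [← Finset.add_sum_erase _ _ (mem_univ x0), inter_self,
      Finset.sum_congr rfl (fun x hx => hsame y0 x x1 (hmem x (mem_erase.mp hx).1)), sum_const,
      card_erase_of_mem (mem_univ _), card_univ, smul_eq_mul, gtM_orbit_card, ← hH] at hs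
    rw [← Nat.card_eq_fintype_card, hcard] at hs
    generalize Nat.card (orbit H y0) = a at *
    generalize (gtM G x0 y0 x0 ∩ gtM G x0 y0 x1).card = c at *
    rw [hcard] at hn
    generalize Nat.card Y = n at *
    have ha : a ≤ 3 := by omega
    interval_cases a <;> interval_cases n <;> omega
  · have hn6 : Nat.card Y = 6 := by omega
    have hall : ∀ y : Y, Nat.card (orbit H y) = 2 := by
      have h1 : ∀ q : orbitRel.Quotient H Y, Nat.card q.orbit = 2 := by
        have : ∑ q : orbitRel.Quotient H Y, 2 = ∑ q : orbitRel.Quotient H Y, Nat.card q.orbit := by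
          rw [hsumY, sum_const, card_univ, ← hkdef, hn6]
          rfl
        intro q
        exact ((Finset.sum_eq_sum_iff_of_le (fun q _ => hsq q)).mp this q (mem_univ q)).symm
      intro y
      exact h1 (Quotient.mk'' y)
    -- squares act trivially
    have hsqY : ∀ g : H, ∀ y : Y, g • g • y = y := by
      intro g y
      by_contra hne
      have h1 : g • y ≠ y := by
        intro h1
        rw [h1, h1] at hne
        exact hne rfl
      have h2 : g • g • y ≠ g • y := by
        intro h2
        exact h1 (smul_left_cancel g h2)
      have hsub : (({y, g • y, g • g • y} : Finset Y) : Set Y) ⊆ orbit H y := by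
        intro z hz
        simp only [coe_insert, coe_singleton, Set.mem_insert_iff, Set.mem_singleton_iff] at hz
        rcases hz with rfl | rfl | rfl
        · exact mem_orbit_self _
        · exact mem_orbit _ _
        · exact ⟨g * g, by simp [mul_smul]⟩
      have h3 := Set.ncard_le_ncard hsub
      rw [Set.ncard_coe_finset, ← Nat.card_coe_set_eq, hall,
        Finset.card_eq_three.mpr ⟨y, g • y, g • g • y, h1.symm, Ne.symm hne, h2.symm, rfl⟩] at h3
      omega
    have hsqX : ∀ g : H, ∀ x : X, g • g • x = x := by
      intro g
      have h1 : fixedBy Y ((g : G) * g) = Set.univ := by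
        ext y
        simp only [mem_fixedBy, Set.mem_univ, iff_true, mul_smul]
        exact hsqY g y
      have h2 := h ((g : G) * g)
      rw [h1, Nat.card_coe_set_eq, Nat.card_coe_set_eq, Set.ncard_univ, ← hcard] at h2
      have h3 : fixedBy X ((g : G) * g) = Set.univ := by
        apply Set.eq_of_subset_of_ncard_le (Set.subset_univ _)
        rw [Set.ncard_univ, h2]
      intro x
      have : x ∈ fixedBy X ((g : G) * g) := h3 ▸ Set.mem_univ x
      rw [mem_fixedBy, mul_smul] at this
      exact this
    -- orbits on X have cardinality a power of two
    have hpow : ∀ x : X, ∃ m, Nat.card (orbit H x) = 2 ^ m := by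
      intro x
      let R := (toPermHom H X).range
      have hR : IsPGroup 2 R := by
        rintro ⟨_, g, rfl⟩
        refine ⟨1, ?_⟩
        apply Subtype.ext
        ext z
        simp only [pow_one, sq]
        exact hsqX g z
      have : Fact (Nat.Prime 2) := ⟨Nat.prime_two⟩
      obtain ⟨m, hm⟩ := hR.card_orbit x
      refine ⟨m, ?_⟩
      rw [← hm]
      have : orbit H x = orbit R x := by
        ext z
        constructor
        · rintro ⟨g, rfl⟩
          exact ⟨⟨toPermHom H X g, g, rfl⟩, rfl⟩
        · rintro ⟨⟨_, g, rfl⟩, rfl⟩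
          exact ⟨g, rfl⟩
      rw [this]
    obtain ⟨qa, qb, hab, hqab⟩ := Finset.card_eq_two.mp hce
    rw [hqab, Finset.sum_pair hab, hcard, hn6] at hsumX
    have hchoose : ∃ x1 x2 : X, x1 ≠ x0 ∧ (∀ x, x ≠ x0 → x ≠ x1 → x ∈ orbit H x2) := by
      have aux : ∀ qa qb : orbitRel.Quotient H X, univ.erase q0 = {qa, qb} →
          Nat.card qa.orbit = 1 → 
          ∃ x1 x2 : X, x1 ≠ x0 ∧ (∀ x, x ≠ x0 → x ≠ x1 → x ∈ orbit H x2) := by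
        intro qa qb hq ha
        induction qa using Quotient.inductionOn' with
        | h x1 =>
        induction qb using Quotient.inductionOn' with
        | h x2 =>
        refine ⟨x1, x2, ?_, ?_⟩
        · rintro rfl
          have : q0 ∈ univ.erase q0 := by
            rw [hq]
            simp [q0]
          simp at this
        · intro x hx0 hx1
          have : (Quotient.mk'' x : orbitRel.Quotient H X) ∈ univ.erase q0 := by
            refine mem_erase.mpr ⟨fun he => ?_, mem_univ _⟩
            obtain ⟨g, hg⟩ := Quotient.exact' he
            apply hx0
            rw [← hg]
            exact g.2
          rw [hq, mem_insert, mem_singleton] at this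
          rcases this with h1 | h1
          · exfalso
            have h2 : x ∈ orbit H x1 := Quotient.exact' h1
            have ha' : Nat.card (orbit H x1) = 1 := ha
            have := (Nat.card_eq_one_iff_unique.mp ha').1
            exact hx1 (congrArg Subtype.val (this.elim ⟨x, h2⟩ ⟨x1, mem_orbit_self x1⟩))
          · exact Quotient.exact' h1
      have hp : ∀ q : orbitRel.Quotient H X, ∃ m, Nat.card q.orbit = 2 ^ m := by
        intro q
        induction q using Quotient.inductionOn' with
        | h y => exact hpow y
      obtain ⟨m, hm⟩ := hp qa
      obtain ⟨m', hm'⟩ := hp qb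
      rcases Nat.eq_zero_or_pos m with rfl | hmp
      · exact aux qa qb hqab (by simpa using hm)
      rcases Nat.eq_zero_or_pos m' with rfl | hmp'
      · exact aux qb qa (by rw [hqab, Finset.pair_comm]) (by simpa using hm')
      exfalso
      have h1 : 2 ∣ 2 ^ m := dvd_pow_self 2 (by omega)
      have h2 : 2 ∣ 2 ^ m' := dvd_pow_self 2 (by omega)
      rw [hm, hm'] at hsumX
      omega
    obtain ⟨x1, x2, hx1, hx2⟩ := hchoose
    -- all relations agree on x0 and x1
    have hMM : ∀ y : Y, gtM G x0 y x1 = gtM G x0 y x0 := by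
      intro y
      have hs := gtM_sum (G := G) hcardF x0 y
      have hm1 : x1 ∈ univ.erase x0 := by simp [hx1]
      rw [← Finset.add_sum_erase _ _ (mem_univ x0), inter_self, ← Finset.add_sum_erase _ _ hm1,
        Finset.sum_congr rfl (fun x hx => hsame y x x2 (hx2 x (by
          simp at hx
          tauto) (by
          simp at hx
          tauto))), sum_const,
        card_erase_of_mem hm1,
        card_erase_of_mem (mem_univ _), card_univ, smul_eq_mul, gtM_orbit_card, ← hH, hall,
        ← Nat.card_eq_fintype_card, hcard, hn6] at hs
      have hle : (gtM G x0 y x0 ∩ gtM G x0 y x1).card = 2 := by omega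
      have hc0 : (gtM G x0 y x0).card = 2 := by rw [gtM_orbit_card, ← hH, hall]
      have hc1 : (gtM G x0 y x1).card = 2 := by
        obtain ⟨g, rfl⟩ := exists_smul_eq G x0 x1
        rw [gtM_card, hc0]
      have e0 := Finset.eq_of_subset_of_card_le
        (inter_subset_left (s₁ := gtM G x0 y x0) (s₂ := gtM G x0 y x1)) (by omega)
      have e1 := Finset.eq_of_subset_of_card_le
        (inter_subset_right (s₁ := gtM G x0 y x0) (s₂ := gtM G x0 y x1)) (by omega)
      rw [← e1, e0]
    obtain ⟨g, hg⟩ := exists_smul_eq G x0 x1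
    have := gt_preserve h H g (fun y => by
      rw [hH, ← gtM_orbit x0 y, mem_coe, ← hMM y, gtM_mem]
      exact ⟨g, hg, rfl⟩) x0
    obtain ⟨k, hk⟩ := this
    apply hx1
    rw [← hg, ← hk]
    exact k.2

end GroupPart

section IdealCount

open Ideal UniqueFactorizationMonoid

/-- The number of ideals of norm `n`. -/
noncomputable def idc (F : Type*) [Field F] [NumberField F] (n : ℕ) : ℕ :=
  Nat.card {I : Ideal (𝓞 F) // Ideal.absNorm I = n}

variable (F : Type*) [Field F] [NumberField F]

lemma idc_one : idc F 1 = 1 := by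
  simp [idc, Ideal.absNorm_eq_one_iff]

lemma absNorm_span_nat (m : ℕ) :
    Ideal.absNorm (Ideal.span {(m : 𝓞 F)}) = m ^ finrank ℚ F := by
  rw [absNorm_span_natCast, RingOfIntegers.rank]

instance idc_finite (n : ℕ) : Finite {I : Ideal (𝓞 F) // Ideal.absNorm I = n} :=
  Ideal.finite_setOfPred_absNorm_eq n

lemma idc_aux_top {m n : ℕ} (h : Nat.Coprime m n) {J : Ideal (𝓞 F)} (hm : (m : 𝓞 F) ∈ J)
    (hn : (n : 𝓞 F) ∈ J) : J = ⊤ := by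
  rw [Ideal.eq_top_iff_one]
  have h1 : IsCoprime (m : ℤ) (n : ℤ) := Nat.isCoprime_iff_coprime.mpr h
  obtain ⟨a, b, hab⟩ := h1
  have h2 : ((a : 𝓞 F) * (m : 𝓞 F) + (b : 𝓞 F) * (n : 𝓞 F)) = 1 := by
    exact_mod_cast congrArg (Int.cast : ℤ → 𝓞 F) hab
  rw [← h2]
  exact J.add_mem (J.mul_mem_left _ hm) (J.mul_mem_left _ hn)

lemma idc_mul {m n : ℕ} (h : Nat.Coprime m n) : idc F (m * n) = idc F m * idc F n := by
  unfold idc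
  rw [← Nat.card_prod]
  symm
  have hmem : ∀ (k : ℕ) (I : Ideal (𝓞 F)), absNorm I = k → (k : 𝓞 F) ∈ I := by
    rintro k I rfl
    exact absNorm_mem I
  have hrec : ∀ (m n : ℕ), Nat.Coprime m n → ∀ J K : Ideal (𝓞 F), absNorm J = m → absNorm K = n →
      J * K ⊔ Ideal.span {(m : 𝓞 F)} = J := by
    intro m n h J K hJ hK
    apply le_antisymm
    · refine sup_le Ideal.mul_le_left ?_
      rw [Ideal.span_singleton_le_iff_mem]
      exact hmem _ _ hJ
    · have ht : K ⊔ Ideal.span {(m : 𝓞 F)} = ⊤ :=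
        idc_aux_top F h (Ideal.mem_sup_right (Ideal.mem_span_singleton_self _))
          (Ideal.mem_sup_left (hmem _ _ hK))
      calc J = J * (K ⊔ Ideal.span {(m : 𝓞 F)}) := by rw [ht, Ideal.mul_top]
        _ = J * K ⊔ J * Ideal.span {(m : 𝓞 F)} := Ideal.mul_sup _ _ _
        _ ≤ _ := sup_le_sup le_rfl Ideal.mul_le_right
  refine Nat.card_congr (Equiv.ofBijective
    (fun P : {I : Ideal (𝓞 F) // absNorm I = m} × {I : Ideal (𝓞 F) // absNorm I = n} =>
      (⟨P.1.1 * P.2.1, by rw [map_mul, P.1.2, P.2.2]⟩ :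
        {I : Ideal (𝓞 F) // absNorm I = m * n})) ⟨?_, ?_⟩)
  · rintro ⟨⟨J, hJ⟩, ⟨K, hK⟩⟩ ⟨⟨J', hJ'⟩, ⟨K', hK'⟩⟩ he
    have he' : J * K = J' * K' := congrArg Subtype.val he
    have e1 : J = J' := by
      rw [← hrec m n h J K hJ hK, ← hrec m n h J' K' hJ' hK', he']
    have e2 : K = K' := by
      rw [← hrec n m h.symm K J hK hJ, ← hrec n m h.symm K' J' hK' hJ', mul_comm K, mul_comm K',
        he']
    subst e1 e2
    rfl
  · rintro ⟨I, hI⟩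
    set J := I ⊔ Ideal.span {(m : 𝓞 F)} with hJ
    set K := I ⊔ Ideal.span {(n : 𝓞 F)} with hK
    have hcop : J ⊔ K = ⊤ := idc_aux_top F h
      (Ideal.mem_sup_left (Ideal.mem_sup_right (Ideal.mem_span_singleton_self _)))
      (Ideal.mem_sup_right (Ideal.mem_sup_right (Ideal.mem_span_singleton_self _)))
    have hJK : J * K = I := by
      apply le_antisymm
      · rw [hJ, hK, Ideal.mul_sup, Ideal.sup_mul, Ideal.sup_mul, Ideal.span_singleton_mul_span_singleton]
        refine sup_le (sup_le Ideal.mul_le_left Ideal.mul_le_right) (sup_le Ideal.mul_le_left ?_)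
        rw [Ideal.span_singleton_le_iff_mem]
        have := hmem _ _ hI
        push_cast at this
        exact this
      · rw [Ideal.mul_eq_inf_of_coprime hcop]
        exact le_inf le_sup_left le_sup_left
    have hN : absNorm J * absNorm K = m * n := by rw [← map_mul, hJK, hI]
    have hJm : absNorm J ∣ m ^ finrank ℚ F := by
      rw [← absNorm_span_nat]
      exact absNorm_dvd_absNorm_of_le le_sup_right
    have hKn : absNorm K ∣ n ^ finrank ℚ F := by
      rw [← absNorm_span_nat]
      exact absNorm_dvd_absNorm_of_le le_sup_right
    have c1 : Nat.Coprime (absNorm J) n := Nat.Coprime.coprime_dvd_left hJm (h.pow_left _)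
    have c2 : Nat.Coprime (absNorm K) m := Nat.Coprime.coprime_dvd_left hKn (h.symm.pow_left _)
    have d1 : absNorm J ∣ m := c1.dvd_of_dvd_mul_right (hN ▸ Dvd.intro _ rfl)
    have d2 : m ∣ absNorm J := c2.symm.dvd_of_dvd_mul_right (hN ▸ Dvd.intro _ rfl)
    have d3 : absNorm K ∣ n := c2.dvd_of_dvd_mul_left (hN ▸ Dvd.intro_left _ rfl)
    have d4 : n ∣ absNorm K := c1.symm.dvd_of_dvd_mul_left (hN ▸ Dvd.intro_left _ rfl)
    exact ⟨⟨⟨J, Nat.dvd_antisymm d1 d2⟩, ⟨K, Nat.dvd_antisymm d3 d4⟩⟩, Subtype.ext hJK⟩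

lemma prime_dvd_absNorm {p : ℕ} (hp : p.Prime) {P : Ideal (𝓞 F)} (hP : P ≠ ⊤)
    (hpP : (p : 𝓞 F) ∈ P) : p ∣ absNorm P := by
  have h1 : absNorm P ∣ p ^ finrank ℚ F := by
    rw [← absNorm_span_nat]
    exact absNorm_dvd_absNorm_of_le (by rwa [Ideal.span_singleton_le_iff_mem])
  obtain ⟨k, -, hk⟩ := (Nat.dvd_prime_pow hp).mp h1
  rw [hk]
  apply dvd_pow_self
  rintro rfl
  rw [pow_zero] at hk
  exact hP (absNorm_eq_one_iff.mp hk)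

lemma idc_pow_le {p : ℕ} (hp : p.Prime) (e : ℕ) : idc F (p ^ e) ≤ (e + 1) ^ finrank ℚ F := by
  classical
  have hpne : Ideal.span {(p : 𝓞 F)} ≠ 0 := by
    simp [hp.ne_zero]
  have hmul : ∀ s : Multiset (Ideal (𝓞 F)), (∀ P ∈ s, p ∣ absNorm P) →
      p ^ s.card ∣ absNorm s.prod := by
    intro s
    induction s using Multiset.induction with
    | empty => simp
    | cons a s ih =>
      intro hs
      rw [Multiset.card_cons, pow_succ', Multiset.prod_cons, map_mul]
      exact mul_dvd_mul (hs a (Multiset.mem_cons_self _ _))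
        (ih fun P hP => hs P (Multiset.mem_cons_of_mem hP))
  set s := normalizedFactors (Ideal.span {(p : 𝓞 F)}) with hs
  have hsmem : ∀ P : Ideal (𝓞 F), P ∈ s ↔ P.IsPrime ∧ (p : 𝓞 F) ∈ P := by
    intro P
    rw [hs, Ideal.mem_normalizedFactors_iff hpne, Ideal.span_singleton_le_iff_mem]
  have hcard : s.card ≤ finrank ℚ F := by
    have h1 := hmul s (fun P hP => prime_dvd_absNorm F hp ((hsmem P).mp hP).1.ne_top
      ((hsmem P).mp hP).2)
    have h2 : s.prod = Ideal.span {(p : 𝓞 F)} := by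
      rw [hs, ← associated_iff_eq]
      exact prod_normalizedFactors hpne
    rw [h2, absNorm_span_nat] at h1
    exact (Nat.pow_dvd_pow_iff_le_right hp.one_lt).mp h1
  let f : {I : Ideal (𝓞 F) // absNorm I = p ^ e} → (s.toFinset → Fin (e + 1)) := fun I P =>
    ⟨(normalizedFactors I.1).count P.1, by
      have hle : Multiset.replicate ((normalizedFactors I.1).count P.1) P.1
          ≤ normalizedFactors I.1 := Multiset.le_count_iff_replicate_le.mp le_rfl
      have hne : I.1 ≠ 0 := by
        intro h0
        have := I.2
        rw [h0] at this
        simp at this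
        exact absurd this.symm (pow_ne_zero _ hp.ne_zero)
      have h3 : (normalizedFactors I.1).prod = I.1 := by
        rw [← associated_iff_eq]
        exact prod_normalizedFactors hne
      have h1 := Multiset.prod_dvd_prod_of_le hle
      rw [h3, Multiset.prod_replicate] at h1
      have h2 := absNorm_dvd_absNorm_of_le (Ideal.le_of_dvd h1)
      rw [map_pow, I.2] at h2
      have hP := (hsmem P.1).mp (Multiset.mem_toFinset.mp P.2)
      have h4 := (pow_dvd_pow_of_dvd (prime_dvd_absNorm F hp hP.1.ne_top hP.2)
        ((normalizedFactors I.1).count P.1)).trans h2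
      exact Nat.lt_succ_of_le ((Nat.pow_dvd_pow_iff_le_right hp.one_lt).mp h4)⟩
  have hf : Function.Injective f := by
    intro I J hIJ
    have hne : ∀ I : {I : Ideal (𝓞 F) // absNorm I = p ^ e}, I.1 ≠ 0 := by
      intro I h0
      have := I.2
      rw [h0] at this
      simp at this
      exact absurd this.symm (pow_ne_zero _ hp.ne_zero)
    have h3 : ∀ I : {I : Ideal (𝓞 F) // absNorm I = p ^ e}, (normalizedFactors I.1).prod = I.1 := by
      intro I
      rw [← associated_iff_eq]
      exact prod_normalizedFactors (hne I)
    have hsub : ∀ I : {I : Ideal (𝓞 F) // absNorm I = p ^ e}, ∀ P, P ∈ normalizedFactors I.1 →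
        P ∈ s := by
      intro I P hP
      rw [Ideal.mem_normalizedFactors_iff (hne I)] at hP
      rw [hsmem]
      refine ⟨hP.1, ?_⟩
      have := hP.2 (absNorm_mem I.1)
      rw [I.2] at this
      push_cast at this
      exact hP.1.mem_of_pow_mem _ this
    apply Subtype.ext
    rw [← h3 I, ← h3 J]
    congr 1
    ext P
    by_cases hP : P ∈ s
    · have := congrFun hIJ ⟨P, Multiset.mem_toFinset.mpr hP⟩
      exact congrArg Fin.val this
    · rw [Multiset.count_eq_zero_of_notMem (fun h => hP (hsub I P h)),
        Multiset.count_eq_zero_of_notMem (fun h => hP (hsub J P h))]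
  have := Nat.card_le_card_of_injective f hf
  rw [Nat.card_fun] at this
  simp only [Nat.card_eq_fintype_card, Fintype.card_fin, Fintype.card_coe] at this
  unfold idc
  refine this.trans (Nat.pow_le_pow_right (by omega) ((Multiset.toFinset_card_le s).trans hcard))

lemma idc_prime_le {p : ℕ} (hp : p.Prime) : idc F p ≤ 2 ^ finrank ℚ F := by
  simpa using idc_pow_le F hp 1

end IdealCount
section Analytic

open Filter Topology

/-- `c` has a logarithmic pole of multiplicity `ν`: the sum over primes of `c p * p ^ (-s)` is
`ν * log (1 / (s - 1)) + O(1)` as `s` tends to `1` from the right. -/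
def LogPole (c : ℕ → ℝ) (ν : ℝ) : Prop :=
  ∃ C : ℝ, ∀ᶠ s : ℝ in 𝓝[>] 1, Summable (fun p : Nat.Primes => c p * (p : ℝ) ^ (-s)) ∧
    |∑' p : Nat.Primes, c p * (p : ℝ) ^ (-s) + ν * Real.log (s - 1)| ≤ C

lemma LogPole.zero : LogPole (fun _ => 0) 0 := ⟨0, by simp [summable_zero]⟩

lemma LogPole.add {c c' : ℕ → ℝ} {ν ν' : ℝ} (h : LogPole c ν) (h' : LogPole c' ν') :
    LogPole (fun p => c p + c' p) (ν + ν') := by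
  obtain ⟨C, hC⟩ := h
  obtain ⟨C', hC'⟩ := h'
  refine ⟨C + C', ?_⟩
  filter_upwards [hC, hC'] with s hs hs'
  simp only [add_mul]
  refine ⟨hs.1.add hs'.1, ?_⟩
  rw [hs.1.tsum_add hs'.1]
  refine le_trans (le_of_eq ?_) ((abs_add_le _ _).trans (add_le_add hs.2 hs'.2))
  congr 1
  ring

lemma LogPole.sum {ι : Type*} (t : Finset ι) (c : ι → ℕ → ℝ) (h : ∀ i, LogPole (c i) 1) :
    LogPole (fun p => ∑ i ∈ t, c i p) t.card := by
  classical
  induction t using Finset.induction_on with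
  | empty => simpa using LogPole.zero
  | insert a t ha ih =>
    have := (h a).add ih
    simp only [Finset.sum_insert ha, Finset.card_insert_of_notMem ha]
    push_cast
    rwa [add_comm (t.card : ℝ)]

lemma LogPole.congr {c c' : ℕ → ℝ} {ν : ℝ} (h : LogPole c ν) (m : ℕ)
    (hm : ∀ p : ℕ, p.Prime → m ≤ p → c p = c' p) : LogPole c' ν := by
  have hfin : (Function.support (fun p : Nat.Primes => c' p - c p)).Finite := by
    have : (Function.support (fun p : Nat.Primes => c' p - c p)) ⊆
        (fun p : Nat.Primes => (p : ℕ)) ⁻¹' (Set.Iio m) := by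
      intro p hp
      by_contra hlt
      apply hp
      have : m ≤ p := by simpa using hlt
      simp [hm p p.2 this]
    exact ((Set.finite_Iio m).preimage (Subtype.val_injective.injOn)).subset this
  have hd : LogPole (fun p => c' p - c p) 0 := by
    have hsum : Summable (fun p : Nat.Primes => |c' p - c p|) := by
      apply summable_of_hasFiniteSupport
      refine hfin.subset ?_
      intro p hp
      simpa using hp
    refine ⟨∑' p : Nat.Primes, |c' p - c p|, ?_⟩
    filter_upwards [self_mem_nhdsWithin] with s hs
    have hs1 : (1 : ℝ) < s := hs
    have hle : ∀ p : Nat.Primes, ‖(c' p - c p) * (p : ℝ) ^ (-s)‖ ≤ |c' p - c p| := by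
      intro p
      rw [norm_mul, Real.norm_eq_abs]
      refine mul_le_of_le_one_right (abs_nonneg _) ?_
      rw [Real.norm_of_nonneg (by positivity)]
      apply Real.rpow_le_one_of_one_le_of_nonpos
      · exact_mod_cast p.2.one_lt.le
      · linarith
    refine ⟨Summable.of_norm_bounded hsum hle, ?_⟩
    rw [zero_mul, add_zero]
    exact tsum_of_norm_bounded hsum.hasSum hle
  have := h.add hd
  simpa using this

lemma LogPole.unique {c : ℕ → ℝ} {ν ν' : ℝ} (h : LogPole c ν) (h' : LogPole c ν') : ν = ν' := by
  by_contra hne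
  obtain ⟨C, hC⟩ := h
  obtain ⟨C', hC'⟩ := h'
  have hlog : Tendsto (fun s : ℝ => Real.log (s - 1)) (𝓝[>] 1) atBot := by
    apply Real.tendsto_log_nhdsGT_zero.comp
    apply tendsto_nhdsWithin_of_tendsto_nhds_of_eventually_within
    · have : Tendsto (fun s : ℝ => s - 1) (𝓝 1) (𝓝 (1 - 1)) := tendsto_id.sub_const 1
      rw [sub_self] at this
      exact this.mono_left nhdsWithin_le_nhds
    · filter_upwards [self_mem_nhdsWithin] with s hs
      exact Set.mem_Ioi.mpr (sub_pos.mpr (Set.mem_Ioi.mp hs))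
  have hpos : 0 < |ν - ν'| := abs_pos.mpr (sub_ne_zero.mpr hne)
  have hev : ∀ᶠ s : ℝ in 𝓝[>] 1, Real.log (s - 1) < -((C + C') / |ν - ν'|) - 1 :=
    hlog.eventually_lt_atBot _
  obtain ⟨s, h1, h2, h3⟩ := (hC.and (hC'.and hev)).exists
  have h4 : |(ν - ν') * Real.log (s - 1)| ≤ C + C' := by
    have := (abs_sub _ _).trans (add_le_add h1.2 h2.2)
    refine le_trans (le_of_eq ?_) this
    congr 1
    ring
  rw [abs_mul] at h4
  have h5 : (C + C') / |ν - ν'| + 1 ≤ |Real.log (s - 1)| := by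
    have := neg_le_abs (Real.log (s - 1))
    linarith
  have h6 := mul_le_mul_of_nonneg_left h5 hpos.le
  rw [mul_add, mul_div_cancel₀ _ hpos.ne'] at h6
  linarith

variable (F : Type*) [Field F] [NumberField F]

/-- The real Dirichlet coefficient times `n ^ (-s)`. -/
noncomputable def zt (s : ℝ) (n : ℕ) : ℝ := idc F n * (n : ℝ) ^ (-s)

lemma zt_nonneg (s : ℝ) (n : ℕ) : 0 ≤ zt F s n := by
  unfold zt
  positivity

lemma zt_zero {s : ℝ} (hs : 1 < s) : zt F s 0 = 0 := by
  unfold zt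
  rw [Nat.cast_zero, Real.zero_rpow (by linarith), mul_zero]

lemma zt_dedekind {s : ℝ} (hs : 1 < s) : dedekindZeta F s = ((∑' n, zt F s n : ℝ) : ℂ) := by
  unfold dedekindZeta LSeries
  rw [Complex.ofReal_tsum]
  refine tsum_congr fun n => ?_
  rcases eq_or_ne n 0 with rfl | hn
  · rw [LSeries.term_zero, zt_zero F hs]
    simp
  · rw [LSeries.term_of_ne_zero hn]
    unfold zt idc
    push_cast
    rw [Real.rpow_neg (by positivity), Complex.ofReal_inv, Complex.ofReal_cpow (by positivity)]
    simp [div_eq_mul_inv]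

lemma zt_bounds : ∃ C : ℝ, ∀ᶠ s : ℝ in 𝓝[>] 1, Summable (zt F s) ∧ 0 < ∑' n, zt F s n ∧
    |Real.log (∑' n, zt F s n) + Real.log (s - 1)| ≤ C := by
  set ρ := dedekindZeta_residue F with hρ
  have hρ0 : 0 < ρ := dedekindZeta_residue_pos F
  have h1 : Tendsto (fun s : ℝ => (s - 1) * ∑' n, zt F s n) (𝓝[>] 1) (𝓝 ρ) := by
    have := (Complex.continuous_re.tendsto _).comp (tendsto_sub_one_mul_dedekindZeta_nhdsGT F)
    rw [Complex.ofReal_re] at this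
    refine this.congr' ?_
    filter_upwards [self_mem_nhdsWithin] with s hs
    simp only [Function.comp]
    rw [zt_dedekind F hs, ← Complex.ofReal_one, ← Complex.ofReal_sub, ← Complex.ofReal_mul,
      Complex.ofReal_re]
  have h2 := (Real.continuousAt_log hρ0.ne').tendsto.comp h1
  refine ⟨|Real.log ρ| + 1, ?_⟩
  have h3 := h2.abs.eventually_le_const (show |Real.log ρ| < |Real.log ρ| + 1 by linarith)
  filter_upwards [self_mem_nhdsWithin, h1.eventually_const_lt hρ0, h3] with s hs hpos hle
  have hs' : 0 < s - 1 := sub_pos.mpr hs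
  have hZ : 0 < ∑' n, zt F s n := pos_of_mul_pos_right hpos hs'.le
  refine ⟨?_, hZ, ?_⟩
  · by_contra hns
    rw [tsum_eq_zero_of_not_summable hns] at hZ
    exact lt_irrefl _ hZ
  · simp only [Function.comp] at hle
    rwa [Real.log_mul hs'.ne' hZ.ne', add_comm] at hle

lemma rpow_le_inv {n : ℕ} (hn : 1 ≤ n) {s : ℝ} (hs : 1 < s) : (n : ℝ) ^ (-s) ≤ (n : ℝ)⁻¹ := by
  rw [← Real.rpow_neg_one]
  apply Real.rpow_le_rpow_of_exponent_le
  · exact_mod_cast hn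
  · linarith

/-- Local factor estimate. -/
lemma local_bound : ∃ B : ℝ, ∀ s : ℝ, 1 < s → Summable (zt F s) → ∀ p : Nat.Primes,
    0 < ∑' e : ℕ, zt F s ((p : ℕ) ^ e) ∧
    |Real.log (∑' e : ℕ, zt F s ((p : ℕ) ^ e)) - idc F p * (p : ℝ) ^ (-s)|
      ≤ B * ((p : ℝ) ^ 2)⁻¹ := by
  set d := finrank ℚ F
  have hsm : Summable (fun e : ℕ => ((e : ℝ) + 3) ^ d * (1 / 2 : ℝ) ^ e) := by
    have h1 : Summable (fun n : ℕ => (n : ℝ) ^ d * (1 / 2 : ℝ) ^ n) :=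
      summable_pow_mul_geometric_of_norm_lt_one d (by norm_num)
    have h2 := ((summable_nat_add_iff 3).mpr h1).mul_left 8
    refine h2.congr fun e => ?_
    push_cast
    rw [pow_add (1 / 2 : ℝ)]
    ring
  set C0 := ∑' e : ℕ, ((e : ℝ) + 3) ^ d * (1 / 2 : ℝ) ^ e with hC0
  have hCnonneg : 0 ≤ C0 := tsum_nonneg fun e => by positivity
  set D : ℝ := 2 ^ d with hD
  refine ⟨C0 + (D + C0) ^ 2, ?_⟩
  intro s hs hsum p
  have hp2 : (2 : ℝ) ≤ p := by exact_mod_cast p.2.two_le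
  have hp0 : (0 : ℝ) < p := by linarith
  have hsp : Summable (fun e : ℕ => zt F s ((p : ℕ) ^ e)) :=
    hsum.comp_injective (Nat.pow_right_injective p.2.two_le)
  set t := ∑' e : ℕ, zt F s ((p : ℕ) ^ (e + 2)) with ht
  have hE : ∑' e : ℕ, zt F s ((p : ℕ) ^ e) = 1 + (idc F p * (p : ℝ) ^ (-s) + t) := by
    rw [← hsp.sum_add_tsum_nat_add 2, Finset.sum_range_succ, Finset.sum_range_one, pow_zero,
      pow_one, add_assoc]
    congr 1
    simp [zt, idc_one]
  have ht0 : 0 ≤ t := tsum_nonneg fun e => zt_nonneg F s _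
  have htle : t ≤ C0 * ((p : ℝ) ^ 2)⁻¹ := by
    rw [hC0, ← tsum_mul_right]
    refine Summable.tsum_le_tsum (fun e => ?_) ((summable_nat_add_iff 2).mpr hsp)
      (hsm.mul_right _)
    unfold zt
    have h1 : (idc F ((p : ℕ) ^ (e + 2)) : ℝ) ≤ ((e : ℝ) + 3) ^ d := by
      have := idc_pow_le F p.2 (e + 2)
      exact_mod_cast this
    have h2 : (((p : ℕ) ^ (e + 2) : ℕ) : ℝ) ^ (-s) ≤ (1 / 2 : ℝ) ^ e * ((p : ℝ) ^ 2)⁻¹ := by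
      refine (rpow_le_inv (Nat.one_le_pow _ _ p.2.pos) hs).trans ?_
      push_cast
      rw [pow_add, mul_inv]
      gcongr
      rw [one_div, inv_pow]
      gcongr
    calc _ ≤ ((e : ℝ) + 3) ^ d * ((1 / 2 : ℝ) ^ e * ((p : ℝ) ^ 2)⁻¹) :=
          mul_le_mul h1 h2 (by positivity) (by positivity)
      _ = _ := by ring
  set a := (idc F p : ℝ) * (p : ℝ) ^ (-s) with ha
  have ha0 : 0 ≤ a := by positivity
  have hale : a ≤ D * (p : ℝ)⁻¹ := by
    have h1 : (idc F p : ℝ) ≤ D := by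
      rw [hD]
      exact_mod_cast idc_prime_le F p.2
    exact mul_le_mul h1 (rpow_le_inv p.2.one_lt.le hs) (by positivity) (by positivity)
  have hinv : ((p : ℝ) ^ 2)⁻¹ ≤ (p : ℝ)⁻¹ := by
    apply inv_anti₀ hp0
    nlinarith
  have hu : a + t ≤ (D + C0) * (p : ℝ)⁻¹ := by
    have := mul_le_mul_of_nonneg_left hinv hCnonneg
    linarith
  have hu2 : (a + t) ^ 2 ≤ (D + C0) ^ 2 * ((p : ℝ) ^ 2)⁻¹ := by
    calc (a + t) ^ 2 ≤ ((D + C0) * (p : ℝ)⁻¹) ^ 2 := by gcongr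
      _ = _ := by rw [mul_pow, inv_pow]
  rw [hE]
  have hpos : 0 < 1 + (a + t) := by linarith
  refine ⟨hpos, ?_⟩
  have hl1 : Real.log (1 + (a + t)) ≤ a + t := by
    have := Real.log_le_sub_one_of_pos hpos
    linarith
  have hl2 : (a + t) - (a + t) ^ 2 ≤ Real.log (1 + (a + t)) := by
    refine le_trans ?_ (Real.one_sub_inv_le_log_of_pos hpos)
    have h7 : (a + t) - (a + t) ^ 2 = 1 - (1 - (a + t) + (a + t) ^ 2) := by ring
    rw [h7]
    apply sub_le_sub_left
    rw [inv_le_iff_one_le_mul₀ hpos]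
    have : 0 ≤ (a + t) ^ 3 := by positivity
    nlinarith
  have hsq : 0 ≤ (a + t) ^ 2 := by positivity
  rw [abs_le, add_mul]
  constructor <;> linarith

theorem field_logPole : LogPole (fun p => (idc F p : ℝ)) 1 := by
  obtain ⟨C, hC⟩ := zt_bounds F
  obtain ⟨B, hB⟩ := local_bound F
  have hsq : Summable (fun p : Nat.Primes => B * ((p : ℝ) ^ 2)⁻¹) := by
    have : Summable (fun n : ℕ => ((n : ℝ) ^ 2)⁻¹) := Real.summable_nat_pow_inv.mpr (by norm_num)
    exact (this.comp_injective (i := fun p : Nat.Primes => (p : ℕ)) Subtype.val_injective).mul_left B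
  refine ⟨C + ∑' p : Nat.Primes, B * ((p : ℝ) ^ 2)⁻¹, ?_⟩
  filter_upwards [self_mem_nhdsWithin, hC] with s hs hZ
  have hs1 : (1 : ℝ) < s := hs
  obtain ⟨hsum, hpos, hlog⟩ := hZ
  have hB' := hB s hs1 hsum
  have hprod : HasProd (fun p : Nat.Primes => ∑' e : ℕ, zt F s ((p : ℕ) ^ e)) (∑' n, zt F s n) := by
    refine EulerProduct.eulerProduct_hasProd ?_ ?_ ?_ (zt_zero F hs1)
    · simp [zt, idc_one]
    · intro m n hmn
      unfold zt
      rw [idc_mul F hmn]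
      push_cast
      rw [Real.mul_rpow (by positivity) (by positivity)]
      ring
    · exact hsum.norm
  have hlogsum : HasSum (fun p : Nat.Primes => Real.log (∑' e : ℕ, zt F s ((p : ℕ) ^ e)))
      (Real.log (∑' n, zt F s n)) := by
    have h1 := (Real.continuousAt_log hpos.ne').tendsto.comp hprod
    refine h1.congr fun t => ?_
    simp only [Function.comp]
    rw [Real.log_prod]
    intro p _
    exact (hB' p).1.ne'
  have hS : Summable (fun p : Nat.Primes => (idc F p : ℝ) * (p : ℝ) ^ (-s)) :=
    hsum.comp_injective (i := fun p : Nat.Primes => (p : ℕ)) Subtype.val_injective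
  refine ⟨hS, ?_⟩
  have hdiff : |Real.log (∑' n, zt F s n) - ∑' p : Nat.Primes, (idc F p : ℝ) * (p : ℝ) ^ (-s)|
      ≤ ∑' p : Nat.Primes, B * ((p : ℝ) ^ 2)⁻¹ := by
    rw [← hlogsum.tsum_eq, ← hlogsum.summable.tsum_sub hS]
    rw [← Real.norm_eq_abs]
    refine tsum_of_norm_bounded hsq.hasSum (fun p => ?_)
    rw [Real.norm_eq_abs]
    exact (hB' p).2
  rw [one_mul]
  rw [abs_le] at *
  constructor <;> linarith [hdiff.1, hdiff.2, hlog.1, hlog.2]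

end Analytic

section Count

open TensorProduct

lemma card_hom_zmod (F : Type*) [Field F] [NumberField F] (p : ℕ) (hp : p.Prime) :
    Nat.card (𝓞 F →+* ZMod p) = idc F p := by
  have := Fact.mk hp
  refine Nat.card_congr (Equiv.ofBijective (fun φ => ⟨RingHom.ker φ, ?_⟩) ⟨?_, ?_⟩)
  · have e := RingHom.quotientKerEquivOfSurjective (ZMod.ringHom_surjective φ)
    rw [Ideal.absNorm_apply, Submodule.cardQuot_apply, Nat.card_congr e.toEquiv, Nat.card_zmod]
  · intro φ ψ h
    have h1 : RingHom.ker φ = RingHom.ker ψ := congrArg Subtype.val h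
    ext x
    obtain ⟨n, hn⟩ := ZMod.intCast_surjective (φ x)
    have h2 : x - (n : 𝓞 F) ∈ RingHom.ker φ := by
      rw [RingHom.mem_ker, map_sub, map_intCast, hn, sub_self]
    rw [h1, RingHom.mem_ker, map_sub, map_intCast, hn, sub_eq_zero] at h2
    exact h2.symm
  · rintro ⟨I, hI⟩
    have hc : Nat.card (𝓞 F ⧸ I) = p := by
      rw [← hI, Ideal.absNorm_apply, Submodule.cardQuot_apply]
    have : Finite (𝓞 F ⧸ I) := Nat.finite_of_card_ne_zero (by rw [hc]; exact hp.ne_zero)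
    have := Fintype.ofFinite (𝓞 F ⧸ I)
    rw [Nat.card_eq_fintype_card] at hc
    let e := (ZMod.ringEquivOfPrime (𝓞 F ⧸ I) hp hc).symm
    refine ⟨(e : (𝓞 F ⧸ I) →+* ZMod p).comp (Ideal.Quotient.mk I), ?_⟩
    apply Subtype.ext
    ext x
    simp [RingHom.mem_ker, Ideal.Quotient.eq_zero_iff_mem]

lemma hom_zmod_finite (F : Type*) [Field F] [NumberField F] (p : ℕ) (hp : p.Prime) :
    Finite (𝓞 F →+* ZMod p) := by
  have := Fact.mk hp
  refine Finite.of_injective (β := {I : Ideal (𝓞 F) // Ideal.absNorm I = p}) 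
    (fun φ => ⟨RingHom.ker φ, ?_⟩) ?_
  · have e := RingHom.quotientKerEquivOfSurjective (ZMod.ringHom_surjective φ)
    rw [Ideal.absNorm_apply, Submodule.cardQuot_apply, Nat.card_congr e.toEquiv, Nat.card_zmod]
  · intro φ ψ h
    have h1 : RingHom.ker φ = RingHom.ker ψ := congrArg Subtype.val h
    ext x
    obtain ⟨n, hn⟩ := ZMod.intCast_surjective (φ x)
    have h2 : x - (n : 𝓞 F) ∈ RingHom.ker φ := by
      rw [RingHom.mem_ker, map_sub, map_intCast, hn, sub_self]
    rw [h1, RingHom.mem_ker, map_sub, map_intCast, hn, sub_eq_zero] at h2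
    exact h2.symm

/-- Extension of homomorphisms along an inclusion with bounded denominators. -/
lemma card_hom_denom {R S : Type*} [CommRing R] [CommRing S] (f : R →+* S)
    (hf : Function.Injective f) (D : ℕ) (hD : ∀ s, ∃ r, f r = D * s) (k : Type*) [Field k]
    (hk : (D : k) ≠ 0) : Nat.card (S →+* k) = Nat.card (R →+* k) := by
  choose g hg using hD
  refine Nat.card_congr (Equiv.ofBijective (fun φ => φ.comp f) ⟨?_, ?_⟩)
  · intro φ ψ h
    ext s
    have h1 : φ (f (g s)) = ψ (f (g s)) := RingHom.congr_fun h (g s)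
    rw [hg, map_mul, map_mul, map_natCast, map_natCast] at h1
    exact mul_left_cancel₀ hk h1
  · intro ψ
    have key : ∀ s r, f r = D * s → ψ (g s) = ψ r := by
      intro s r h
      congr 1
      exact hf (by rw [hg, h])
    refine ⟨{ toFun := fun s => (D : k)⁻¹ * ψ (g s)
              map_one' := ?_, map_mul' := ?_, map_zero' := ?_, map_add' := ?_ }, ?_⟩
    · rw [key 1 D (by simp), map_natCast, inv_mul_cancel₀ hk]
    · intro x y
      have h1 : ψ (g (x * y)) * D = ψ (g x) * ψ (g y) := by
        rw [← map_natCast ψ D, ← map_mul, ← map_mul]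
        congr 1
        apply hf
        simp only [map_mul, hg, map_natCast]
        ring
      field_simp
      rw [mul_comm, h1]
    · rw [key 0 0 (by simp)]
      simp
    · intro x y
      rw [key (x + y) (g x + g y) (by rw [map_add, hg, hg]; ring), map_add, mul_add]
    · ext r
      simp only [RingHom.comp_apply, RingHom.coe_mk, MonoidHom.coe_mk, OneHom.coe_mk]
      rw [key (f r) (D * r) (by simp), map_mul, map_natCast, inv_mul_cancel_left₀ hk]

lemma card_hom_pi {ι : Type*} [Fintype ι] (S : ι → Type*) [∀ i, CommRing (S i)] (k : Type*)
    [Field k] [∀ i, Finite (S i →+* k)] :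
    Nat.card ((∀ i, S i) →+* k) = ∑ i, Nat.card (S i →+* k) := by
  classical
  rw [← Nat.card_sigma]
  symm
  refine Nat.card_congr (Equiv.ofBijective
    (fun q : Σ i, (S i →+* k) => q.2.comp (Pi.evalRingHom S q.1)) ⟨?_, ?_⟩)
  · rintro ⟨i, f⟩ ⟨j, g⟩ h
    have hij : i = j := by
      by_contra hne
      have := RingHom.congr_fun h (Pi.single i 1)
      simp [Ne.symm hne, Pi.single_eq_of_ne] at this
    subst hij
    congr 1
    ext x
    have := RingHom.congr_fun h (Pi.single i x)
    simpa using this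
  · intro φ
    have h1 : ∑ i, φ (Pi.single i 1) = 1 := by
      rw [← map_sum, Finset.univ_sum_single (fun i => (1 : S i))]
      exact map_one φ
    obtain ⟨i, -, hi⟩ := Finset.exists_ne_zero_of_sum_ne_zero (h1.trans_ne one_ne_zero)
    have hi1 : φ (Pi.single i 1) = 1 := by
      have : φ (Pi.single i 1) * φ (Pi.single i 1) = φ (Pi.single i 1) := by
        rw [← map_mul, ← Pi.single_mul, one_mul]
      exact mul_left_cancel₀ hi (by rw [this, mul_one])
    have key : ∀ x, φ (Pi.single i (x i)) = φ x := by
      intro x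
      have : Pi.single i (x i) = Pi.single i 1 * x := by
        ext j
        by_cases hj : j = i
        · subst hj; simp
        · simp [hj]
      rw [this, map_mul, hi1, one_mul]
    refine ⟨⟨i, { toFun := fun x => φ (Pi.single i x)
                  map_one' := hi1
                  map_mul' := fun x y => by rw [Pi.single_mul, map_mul]
                  map_zero' := by simp
                  map_add' := fun x y => by rw [Pi.single_add, map_add] }⟩, ?_⟩
    refine RingHom.ext fun x => ?_
    exact key x

/-- Ring homomorphisms are the same as homomorphisms of `ℤ`-algebras. -/
def intHomEquiv (R k : Type*) [CommRing R] [CommRing k] : (R →+* k) ≃ (R →ₐ[ℤ] k) where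
  toFun f := f.toIntAlgHom
  invFun f := f.toRingHom
  left_inv f := by ext; rfl
  right_inv f := by ext; rfl

lemma card_hom_tensor (R S : Type*) [CommRing R] [CommRing S] (k : Type*) [Field k] :
    Nat.card (R ⊗[ℤ] S →+* k) = Nat.card (R →+* k) * Nat.card (S →+* k) := by
  rw [← Nat.card_prod]
  refine Nat.card_congr ?_
  refine (intHomEquiv (R ⊗[ℤ] S) k).trans ?_
  refine (Algebra.TensorProduct.liftEquiv (R := ℤ) (S := ℤ) (A := R) (B := S) (C := k)).symm.trans ?_
  refine (Equiv.subtypeUnivEquiv (fun _ _ _ => Commute.all _ _)).trans ?_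
  exact Equiv.prodCongr (intHomEquiv _ _).symm (intHomEquiv _ _).symm

lemma exists_denom {M : Type*} [AddCommGroup M] [Module.Finite ℤ M] (N : Submodule ℤ M)
    (h : ∀ m, ∃ n : ℕ, n ≠ 0 ∧ (n : ℤ) • m ∈ N) : ∃ D : ℕ, D ≠ 0 ∧ ∀ m, (D : ℤ) • m ∈ N := by
  classical
  choose d hd hdN using h
  obtain ⟨s, hs⟩ := (Module.Finite.fg_top : (⊤ : Submodule ℤ M).FG)
  refine ⟨∏ m ∈ s, d m, Finset.prod_ne_zero_iff.mpr fun m _ => hd m, ?_⟩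
  intro m
  have hm : m ∈ Submodule.span ℤ (s : Set M) := by rw [hs]; trivial
  induction hm using Submodule.span_induction with
  | mem x hx =>
    rw [← Finset.prod_erase_mul s d hx, Nat.cast_mul, mul_smul]
    exact N.smul_mem _ (hdN x)
  | zero => simp
  | add x y _ _ hx hy => rw [smul_add]; exact N.add_mem hx hy
  | smul a x _ hx => rw [smul_comm]; exact N.smul_mem _ hx

section Decomp
variable (K L : Type*) [Field K] [NumberField K] [Field L] [NumberField L]

/-- The canonical map from the tensor product of rings of integers. -/
noncomputable def tenInt : 𝓞 K ⊗[ℤ] 𝓞 L →+* K ⊗[ℚ] L :=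
  ((Algebra.TensorProduct.equivOfCompatibleSMul ℚ ℤ ℤ K L : K ⊗[ℤ] L ≃ₐ[ℤ] K ⊗[ℚ] L) :
    K ⊗[ℤ] L →+* K ⊗[ℚ] L).comp
  (Algebra.TensorProduct.map (algebraMap (𝓞 K) K).toIntAlgHom
    (algebraMap (𝓞 L) L).toIntAlgHom : 𝓞 K ⊗[ℤ] 𝓞 L →ₐ[ℤ] K ⊗[ℤ] L).toRingHom

lemma tenInt_tmul (x : 𝓞 K) (y : 𝓞 L) : tenInt K L (x ⊗ₜ y) = (x : K) ⊗ₜ (y : L) := by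
  simp only [tenInt]
  rfl

lemma tenInt_injective : Function.Injective (tenInt K L) := by
  have h : Function.Injective (TensorProduct.map
      ((algebraMap (𝓞 K) K).toIntAlgHom.toLinearMap)
      ((algebraMap (𝓞 L) L).toIntAlgHom.toLinearMap)) := by
    apply TensorProduct.map_injective_of_flat_flat
    · exact RingOfIntegers.coe_injective
    · exact RingOfIntegers.coe_injective
  exact (Algebra.TensorProduct.equivOfCompatibleSMul ℚ ℤ ℤ K L).injective.comp h

lemma exists_int_mult (x : K) : ∃ n : ℕ, n ≠ 0 ∧ ∃ r : 𝓞 K, (r : K) = n * x := by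
  have hx : IsAlgebraic ℤ x := (IsFractionRing.isAlgebraic_iff ℤ ℚ K).mpr (Algebra.IsAlgebraic.isAlgebraic x)
  obtain ⟨y, hy, h⟩ := hx.exists_integral_multiple
  refine ⟨y.natAbs, by simpa using hy, ?_⟩
  have h2 : IsIntegral ℤ ((y.natAbs : K) * x) := by
    rcases Int.natAbs_eq y with h1 | h1
    · rw [h1, zsmul_eq_mul] at h
      simpa using h
    · rw [h1, zsmul_eq_mul] at h
      simpa using h.neg
  exact ⟨⟨_, h2⟩, rfl⟩

lemma tenInt_denom (a : K ⊗[ℚ] L) : ∃ n : ℕ, n ≠ 0 ∧ ∃ r, tenInt K L r = n * a := by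
  induction a using TensorProduct.induction_on with
  | zero => exact ⟨1, one_ne_zero, 0, by simp⟩
  | tmul x y =>
    obtain ⟨n, hn, r, hr⟩ := exists_int_mult K x
    obtain ⟨m, hm, t, ht⟩ := exists_int_mult L y
    refine ⟨n * m, mul_ne_zero hn hm, r ⊗ₜ t, ?_⟩
    rw [tenInt_tmul, hr, ht, ← Algebra.TensorProduct.tmul_mul_tmul, Nat.cast_mul]
    congr 1
    rw [← mul_one (n : K), ← one_mul (m : L), ← Algebra.TensorProduct.tmul_mul_tmul]
    congr 1
    exact map_natCast (Algebra.TensorProduct.includeRight : L →ₐ[ℚ] K ⊗[ℚ] L) m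
  | add x y hx hy =>
    obtain ⟨n, hn, r, hr⟩ := hx
    obtain ⟨m, hm, t, ht⟩ := hy
    refine ⟨n * m, mul_ne_zero hn hm, m * r + n * t, ?_⟩
    simp only [map_add, map_mul, map_natCast, hr, ht, Nat.cast_mul]
    ring

lemma decomp_count {ι : Type*} [Fintype ι] (F : ι → Type*) [∀ i, Field (F i)]
    [∀ i, NumberField (F i)] (e : K ⊗[ℚ] L ≃+* ∀ i, F i) :
    ∃ m : ℕ, ∀ p, p.Prime → m ≤ p → idc K p * idc L p = ∑ i, idc (F i) p := by
  let f0 : ∀ i, 𝓞 K ⊗[ℤ] 𝓞 L →+* F i := fun i =>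
    ((Pi.evalRingHom F i).comp (e : K ⊗[ℚ] L →+* ∀ i, F i)).comp (tenInt K L)
  have hIntegral : ∀ i r, IsIntegral ℤ (f0 i r) := by
    intro i r
    obtain ⟨q, hq, h⟩ := Algebra.IsIntegral.isIntegral (R := ℤ) r
    refine ⟨q, hq, ?_⟩
    have h' := congrArg (f0 i) h
    rw [Polynomial.hom_eval₂, map_zero] at h'
    rw [← h']
    congr 1
    exact Subsingleton.elim _ _
  let f : 𝓞 K ⊗[ℤ] 𝓞 L →+* ∀ i, 𝓞 (F i) := RingHom.pi (fun i =>
    ((f0 i).codRestrict (integralClosure ℤ (F i)) (hIntegral i) : 𝓞 K ⊗[ℤ] 𝓞 L →+* 𝓞 (F i)))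
  have hf : ∀ r i, ((f r i : 𝓞 (F i)) : F i) = e (tenInt K L r) i := fun r i => rfl
  have hinj : Function.Injective f := by
    intro r t h
    apply tenInt_injective K L
    apply e.injective
    funext i
    rw [← hf, ← hf, h]
  obtain ⟨D, hD0, hD⟩ := exists_denom (M := ∀ i, 𝓞 (F i))
    (LinearMap.range f.toIntAlgHom.toLinearMap) (by
      intro s
      obtain ⟨n, hn, r, hr⟩ := tenInt_denom K L (e.symm (fun i => (s i : F i)))
      refine ⟨n, hn, r, ?_⟩
      funext i
      apply RingOfIntegers.coe_injective
      change e (tenInt K L r) i = _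
      rw [hr, map_mul, map_natCast]
      simp)
  refine ⟨D + 1, fun p hp hpD => ?_⟩
  have := Fact.mk hp
  have hk : (D : ZMod p) ≠ 0 := by
    rw [Ne, ZMod.natCast_eq_zero_iff]
    intro h
    have := Nat.le_of_dvd (Nat.pos_of_ne_zero hD0) h
    omega
  have : ∀ i, Finite (𝓞 (F i) →+* ZMod p) := fun i => hom_zmod_finite (F i) p hp
  have h1 := card_hom_denom f hinj D (fun s => by
    obtain ⟨r, hr⟩ := hD s
    exact ⟨r, hr.trans (by simp [Algebra.smul_def])⟩) (ZMod p) hk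
  rw [card_hom_tensor, card_hom_pi, card_hom_zmod K p hp, card_hom_zmod L p hp] at h1
  rw [← h1]
  exact Finset.sum_congr rfl fun i _ => card_hom_zmod (F i) p hp
end Decomp
end Count

section Galois
open TensorProduct MulAction

lemma hom_trans {k N E : Type*} [Field k] [Field N] [Algebra k N] [Normal k N]
    [Field E] [Algebra k E] (σ τ : E →ₐ[k] N) : ∃ g : N ≃ₐ[k] N, ∀ x, g (σ x) = τ x := by
  let eσ : E ≃ₐ[k] σ.fieldRange := AlgEquiv.ofInjectiveField σ
  let eτ : E ≃ₐ[k] τ.fieldRange := AlgEquiv.ofInjectiveField τ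
  refine ⟨(eσ.symm.trans eτ).liftNormal N, fun x => ?_⟩
  have h := (eσ.symm.trans eτ).liftNormal_commutes N (eσ x)
  have h1 : algebraMap σ.fieldRange N (eσ x) = σ x := rfl
  rw [h1] at h
  rw [h]
  simp only [AlgEquiv.trans_apply, AlgEquiv.symm_apply_apply]
  rfl

section Trans
variable {N : Type*} [Field N] [Algebra ℚ N] [FiniteDimensional ℚ N] [IsGalois ℚ N]

/-- The Galois group acts on embeddings by composition. -/
instance homAction (E : Type*) [Field E] [Algebra ℚ E] : MulAction (N ≃ₐ[ℚ] N) (E →ₐ[ℚ] N) where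
  smul g φ := (g : N →ₐ[ℚ] N).comp φ
  one_smul φ := by ext; rfl
  mul_smul g h φ := by ext; rfl

lemma homAction_apply {E : Type*} [Field E] [Algebra ℚ E] (g : N ≃ₐ[ℚ] N) (φ : E →ₐ[ℚ] N) (x : E) :
    (g • φ) x = g (φ x) := rfl

instance hom_pretrans (E : Type*) [Field E] [Algebra ℚ E] :
    IsPretransitive (N ≃ₐ[ℚ] N) (E →ₐ[ℚ] N) where
  exists_smul_eq σ τ := by
    obtain ⟨g, hg⟩ := hom_trans σ τ
    exact ⟨g, AlgHom.ext hg⟩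
end Trans

section Orbits
variable (K L : Type*) [Field K] [NumberField K] [Field L] [NumberField L]

instance tensor_finite : Module.Finite ℚ (K ⊗[ℚ] L) := inferInstance

instance tensor_artinian : IsArtinianRing (K ⊗[ℚ] L) := IsArtinianRing.of_finite ℚ _

instance tensor_reduced : IsReduced (K ⊗[ℚ] L) := by
  have : Algebra.FormallyUnramified ℚ K := Algebra.FormallyUnramified.of_isSeparable ℚ K
  have : Algebra.FormallyUnramified ℚ L := Algebra.FormallyUnramified.of_isSeparable ℚ L
  have : Algebra.FormallyUnramified K (K ⊗[ℚ] L) := inferInstance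
  have : Algebra.FormallyUnramified ℚ (K ⊗[ℚ] L) := Algebra.FormallyUnramified.comp ℚ K _
  exact Algebra.FormallyUnramified.isReduced_of_field ℚ _

/-- The number of field composites. -/
noncomputable def compNum : ℕ := Nat.card (MaximalSpectrum (K ⊗[ℚ] L))

lemma pair_logPole : LogPole (fun p => (idc K p : ℝ) * idc L p) (compNum K L) := by
  have := Fintype.ofFinite (MaximalSpectrum (K ⊗[ℚ] L))
  let : ∀ i : MaximalSpectrum (K ⊗[ℚ] L), Field ((K ⊗[ℚ] L) ⧸ i.asIdeal) := fun i =>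
    Ideal.Quotient.field i.asIdeal
  have : ∀ i : MaximalSpectrum (K ⊗[ℚ] L), NumberField ((K ⊗[ℚ] L) ⧸ i.asIdeal) := fun i => by
    have h0 : CharZero ((K ⊗[ℚ] L) ⧸ i.asIdeal) := algebraRat.charZero _
    have h1 : Module.Finite ℚ ((K ⊗[ℚ] L) ⧸ i.asIdeal) := inferInstance
    have h2 : @FiniteDimensional ℚ ((K ⊗[ℚ] L) ⧸ i.asIdeal) _ _ DivisionRing.toRatAlgebra.toModule := by
      convert h1
      exact Subsingleton.elim _ _
    exact { to_charZero := h0, to_finiteDimensional := h2 }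
  obtain ⟨m, hm⟩ := decomp_count K L (fun i : MaximalSpectrum (K ⊗[ℚ] L) => (K ⊗[ℚ] L) ⧸ i.asIdeal)
    (IsArtinianRing.equivPi (K ⊗[ℚ] L)).toRingEquiv
  have h1 := LogPole.sum Finset.univ
    (fun (i : MaximalSpectrum (K ⊗[ℚ] L)) p => (idc ((K ⊗[ℚ] L) ⧸ i.asIdeal) p : ℝ))
    (fun i => field_logPole _)
  rw [compNum, Nat.card_eq_fintype_card, ← Finset.card_univ]
  refine LogPole.congr h1 m fun p hp hpm => ?_
  have := hm p hp hpm
  exact_mod_cast this.symm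

variable {N : Type*} [Field N] [Algebra ℚ N] [FiniteDimensional ℚ N] [IsGalois ℚ N]

lemma productMap_smul (g : N ≃ₐ[ℚ] N) (φ : K →ₐ[ℚ] N) (ψ : L →ₐ[ℚ] N) (a : K ⊗[ℚ] L) :
    Algebra.TensorProduct.productMap (g • φ) (g • ψ) a
      = g (Algebra.TensorProduct.productMap φ ψ a) := by
  have : Algebra.TensorProduct.productMap (g • φ) (g • ψ)
      = (g : N →ₐ[ℚ] N).comp (Algebra.TensorProduct.productMap φ ψ) := by
    ext x <;> simp [homAction_apply]
  rw [this]
  rfl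

lemma card_orbits (i : K →ₐ[ℚ] N) (j : L →ₐ[ℚ] N) :
    Nat.card (orbitRel.Quotient (N ≃ₐ[ℚ] N) ((K →ₐ[ℚ] N) × (L →ₐ[ℚ] N))) = compNum K L := by
  let kr : ((K →ₐ[ℚ] N) × (L →ₐ[ℚ] N)) → MaximalSpectrum (K ⊗[ℚ] L) := fun q =>
    ⟨RingHom.ker (Algebra.TensorProduct.productMap q.1 q.2), by
      have := RingHom.ker_isPrime (Algebra.TensorProduct.productMap q.1 q.2)
      exact IsArtinianRing.isMaximal_of_isPrime _⟩
  have hkr : ∀ q q', (orbitRel (N ≃ₐ[ℚ] N) ((K →ₐ[ℚ] N) × (L →ₐ[ℚ] N))).r q q' → kr q = kr q' := by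
    rintro q q' ⟨g, hg⟩
    apply MaximalSpectrum.ext
    ext a
    subst hg
    change Algebra.TensorProduct.productMap (g • q'.1) (g • q'.2) a = 0 ↔ 
      Algebra.TensorProduct.productMap q'.1 q'.2 a = 0
    rw [productMap_smul]
    simp
  refine Nat.card_congr (Equiv.ofBijective (Quotient.lift kr hkr) ⟨?_, ?_⟩)
  · intro a b
    induction a using Quotient.inductionOn with | _ q
    induction b using Quotient.inductionOn with | _ q'
    intro h
    have h1 : RingHom.ker (Algebra.TensorProduct.productMap q.1 q.2) =
      RingHom.ker (Algebra.TensorProduct.productMap q'.1 q'.2) := congrArg MaximalSpectrum.asIdeal h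
    let m := RingHom.ker (Algebra.TensorProduct.productMap q'.1 q'.2)
    have hm : m.IsMaximal := (kr q').isMaximal
    let : Field ((K ⊗[ℚ] L) ⧸ m) := Ideal.Quotient.field m
    let σ : ((K ⊗[ℚ] L) ⧸ m) →ₐ[ℚ] N := Ideal.Quotient.liftₐ m
      (Algebra.TensorProduct.productMap q'.1 q'.2) (fun a ha => ha)
    let τ : ((K ⊗[ℚ] L) ⧸ m) →ₐ[ℚ] N := Ideal.Quotient.liftₐ m
      (Algebra.TensorProduct.productMap q.1 q.2) (fun a ha => by
        have : a ∈ RingHom.ker (Algebra.TensorProduct.productMap q.1 q.2) := h1 ▸ ha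
        exact this)
    obtain ⟨g, hg⟩ := hom_trans σ τ
    apply Quotient.sound
    refine ⟨g, ?_⟩
    have key : ∀ a, g (Algebra.TensorProduct.productMap q'.1 q'.2 a) =
      Algebra.TensorProduct.productMap q.1 q.2 a := fun a => hg (Ideal.Quotient.mk m a)
    apply Prod.ext
    · ext x
      have := key (x ⊗ₜ 1)
      simpa [homAction_apply] using this
    · ext x
      have := key (1 ⊗ₜ x)
      simpa [homAction_apply] using this
  · rintro ⟨m, hm⟩
    let : Field ((K ⊗[ℚ] L) ⧸ m) := Ideal.Quotient.field m
    let u : K →ₐ[ℚ] ((K ⊗[ℚ] L) ⧸ m) := (Ideal.Quotient.mkₐ ℚ m).comp Algebra.TensorProduct.includeLeft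
    let v : L →ₐ[ℚ] ((K ⊗[ℚ] L) ⧸ m) := (Ideal.Quotient.mkₐ ℚ m).comp Algebra.TensorProduct.includeRight
    have hne : Nonempty (((K ⊗[ℚ] L) ⧸ m) →ₐ[ℚ] N) := by
      apply IntermediateField.nonempty_algHom_of_adjoin_splits (S := Set.range u ∪ Set.range v)
      · rintro s (⟨x, rfl⟩ | ⟨x, rfl⟩)
        · refine ⟨(Algebra.IsIntegral.isIntegral x).map u, ?_⟩
          rw [minpoly.algHom_eq u u.injective, ← minpoly.algHom_eq i i.injective]
          exact Normal.splits inferInstance _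
        · refine ⟨(Algebra.IsIntegral.isIntegral x).map v, ?_⟩
          rw [minpoly.algHom_eq v v.injective, ← minpoly.algHom_eq j j.injective]
          exact Normal.splits inferInstance _
      · rw [eq_top_iff]
        rintro a -
        obtain ⟨a, rfl⟩ := Ideal.Quotient.mk_surjective a
        induction a using TensorProduct.induction_on with
        | zero => simp
        | tmul x y =>
          have : Ideal.Quotient.mk m (x ⊗ₜ y) = u x * v y := by
            rw [← mul_one x, ← one_mul y, ← Algebra.TensorProduct.tmul_mul_tmul, map_mul]
            simp [u, v]
          rw [this]
          exact mul_mem (IntermediateField.subset_adjoin _ _ (Or.inl ⟨x, rfl⟩))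
            (IntermediateField.subset_adjoin _ _ (Or.inr ⟨y, rfl⟩))
        | add x y hx hy => rw [map_add]; exact add_mem hx hy
    obtain ⟨w⟩ := hne
    refine ⟨Quotient.mk _ (w.comp u, w.comp v), ?_⟩
    change kr (w.comp u, w.comp v) = _
    apply MaximalSpectrum.ext
    have : Algebra.TensorProduct.productMap (w.comp u) (w.comp v) = w.comp (Ideal.Quotient.mkₐ ℚ m) := by
      ext x <;> simp [u, v, ← Algebra.TensorProduct.one_def]
    ext a
    change Algebra.TensorProduct.productMap (w.comp u) (w.comp v) a = 0 ↔ a ∈ m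
    rw [this]
    simp [Ideal.Quotient.eq_zero_iff_mem]
end Orbits
end Galois

section Final
open MulAction

lemma embed_of_fix {k N K L : Type*} [Field k] [Field N] [Algebra k N] [FiniteDimensional k N]
    [IsGalois k N] [Field K] [Algebra k K] [Field L] [Algebra k L] (i : K →ₐ[k] N) (ψ : L →ₐ[k] N)
    (h : ∀ g : N ≃ₐ[k] N, (∀ x, g (i x) = i x) → ∀ y, g (ψ y) = ψ y) : Nonempty (L →ₐ[k] K) := by
  have h1 : ∀ y, ψ y ∈ i.range := by
    intro y
    have h2 : ψ y ∈ IntermediateField.fixedField (IntermediateField.fixingSubgroup i.fieldRange) := by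
      rw [IntermediateField.mem_fixedField_iff]
      intro g hg
      rw [IntermediateField.mem_fixingSubgroup_iff] at hg
      exact h g (fun x => hg _ ⟨x, rfl⟩) y
    rw [IsGalois.fixedField_fixingSubgroup] at h2
    exact h2
  exact ⟨((AlgEquiv.ofInjectiveField i).symm : i.range →ₐ[k] K).comp (ψ.codRestrict i.range h1)⟩

lemma exists_galois.{u, v, w} {k : Type u} {K : Type v} {L : Type w} [Field k] [CharZero k] [Field K] [Algebra k K]
    [FiniteDimensional k K] [Field L] [Algebra k L] [FiniteDimensional k L] :
    ∃ (N : Type u) (_ : Field N) (_ : Algebra k N), FiniteDimensional k N ∧ IsGalois k N ∧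
      Nonempty (K →ₐ[k] N) ∧ Nonempty (L →ₐ[k] N) := by
  obtain ⟨α, hα⟩ := Field.exists_primitive_element k K
  obtain ⟨β, hβ⟩ := Field.exists_primitive_element k L
  let P := minpoly k α * minpoly k β
  have hα1 : IsIntegral k α := Algebra.IsIntegral.isIntegral α
  have hβ1 : IsIntegral k β := Algebra.IsIntegral.isIntegral β
  have hP0 : P ≠ 0 := mul_ne_zero (minpoly.ne_zero hα1) (minpoly.ne_zero hβ1)
  have hP := Polynomial.SplittingField.splits P
  have hP0' : P.map (algebraMap k P.SplittingField) ≠ 0 := by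
    simpa using hP0
  have hN : Normal k P.SplittingField := Normal.of_isSplittingField P
  refine ⟨P.SplittingField, inferInstance, inferInstance, inferInstance, ⟨⟩, ?_, ?_⟩
  · refine IntermediateField.nonempty_algHom_of_adjoin_splits (S := {α}) ?_ hα
    rintro s rfl
    exact ⟨hα1, hP.of_dvd hP0' (Polynomial.map_dvd _ (dvd_mul_right _ _))⟩
  · refine IntermediateField.nonempty_algHom_of_adjoin_splits (S := {β}) ?_ hβ
    rintro s rfl
    exact ⟨hβ1, hP.of_dvd hP0' (Polynomial.map_dvd _ (dvd_mul_left _ _))⟩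

lemma burnside_nat (G X : Type*) [Group G] [Fintype G] [MulAction G X] [Finite X] :
    ∑ g : G, Nat.card (fixedBy X g) = Nat.card (orbitRel.Quotient G X) * Nat.card G := by
  classical
  have := Fintype.ofFinite X
  have := Fintype.ofFinite (orbitRel.Quotient G X)
  have h := sum_card_fixedBy_eq_card_orbits_mul_card_group G X
  simp only [Nat.card_eq_fintype_card]
  exact h

lemma card_fixedBy_prod {G X Y : Type*} [Group G] [MulAction G X] [MulAction G Y] (g : G) :
    Nat.card (fixedBy (X × Y) g) = Nat.card (fixedBy X g) * Nat.card (fixedBy Y g) := by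
  rw [← Nat.card_prod]
  refine Nat.card_congr ⟨fun q => (⟨q.1.1, congrArg Prod.fst q.2⟩, ⟨q.1.2, congrArg Prod.snd q.2⟩),
    fun q => ⟨(q.1.1, q.2.1), Prod.ext q.1.2 q.2.2⟩, fun _ => rfl, fun _ => rfl⟩

lemma fixedBy_eq {G X Y : Type*} [Group G] [Finite G] [MulAction G X] [MulAction G Y] [Finite X]
    [Finite Y]
    (h1 : Nat.card (orbitRel.Quotient G (X × X)) = Nat.card (orbitRel.Quotient G (X × Y)))
    (h2 : Nat.card (orbitRel.Quotient G (Y × Y)) = Nat.card (orbitRel.Quotient G (X × Y))) (g : G) :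
    Nat.card (fixedBy X g) = Nat.card (fixedBy Y g) := by
  have := Fintype.ofFinite G
  have e1 := burnside_nat G (X × X)
  have e2 := burnside_nat G (Y × Y)
  have e3 := burnside_nat G (X × Y)
  rw [h1, ← e3] at e1
  rw [h2, ← e3] at e2
  simp only [card_fixedBy_prod] at e1 e2
  zify at e1 e2
  have h0 : ∑ g : G, ((Nat.card (fixedBy X g) : ℤ) - Nat.card (fixedBy Y g)) ^ 2 = 0 := by
    have : ∀ g : G, ((Nat.card (fixedBy X g) : ℤ) - Nat.card (fixedBy Y g)) ^ 2 =
      ((Nat.card (fixedBy X g) : ℤ) * Nat.card (fixedBy X g)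
        - (Nat.card (fixedBy X g) : ℤ) * Nat.card (fixedBy Y g)) +
      ((Nat.card (fixedBy Y g) : ℤ) * Nat.card (fixedBy Y g)
        - (Nat.card (fixedBy X g) : ℤ) * Nat.card (fixedBy Y g)) := fun g => by ring
    rw [Finset.sum_congr rfl fun g _ => this g, Finset.sum_add_distrib, Finset.sum_sub_distrib,
      Finset.sum_sub_distrib, e1, e2]
    simp
  have h3 := (Finset.sum_eq_zero_iff_of_nonneg (fun g _ => sq_nonneg _)).mp h0 g (Finset.mem_univ g)
  have h4 := sub_eq_zero.mp (pow_eq_zero_iff (two_ne_zero)|>.mp h3)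
  exact_mod_cast h4

lemma embed_main (K L : Type*) [Field K] [NumberField K] [Field L] [NumberField L]
    (hdeg : finrank ℚ K < 7) (hz : ∀ n, idc K n = idc L n) : Nonempty (L →ₐ[ℚ] K) := by
  obtain ⟨N, _, _, _, _, ⟨i⟩, ⟨j⟩⟩ := exists_galois (k := ℚ) (K := K) (L := L)
  have hKK := pair_logPole K K
  have hKL := pair_logPole K L
  have hLL := pair_logPole L L
  simp only [hz] at hKK hKL
  have n1 : compNum K K = compNum K L := by exact_mod_cast hKK.unique hKL
  have n2 : compNum L L = compNum K L := by exact_mod_cast hLL.unique hKL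
  have hfix : ∀ g : N ≃ₐ[ℚ] N, Nat.card (fixedBy (K →ₐ[ℚ] N) g) = Nat.card (fixedBy (L →ₐ[ℚ] N) g) :=
    fixedBy_eq (by rw [card_orbits K K i i, card_orbits K L i j, n1])
      (by rw [card_orbits L L j j, card_orbits K L i j, n2])
  have hX : Nat.card (K →ₐ[ℚ] N) ≤ 6 := by
    have := card_algHom_le_finrank ℚ K N
    omega
  obtain ⟨ψ, hψ⟩ := gt_main hX hfix i
  refine embed_of_fix i ψ fun g hg y => ?_
  exact AlgHom.congr_fun (hψ g (AlgHom.ext hg)) y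

end Final

/-- Arithmetically equivalent number fields (i.e. fields whose Dedekind zeta
functions coincide; equivalently, having the same number of ideals of every norm) of degree
less than `7` are isomorphic. -/
theorem statement_12 (K L : Type*) [Field K] [NumberField K] [Field L] [NumberField L]
    (hdeg : finrank ℚ K < 7) (hdeg' : finrank ℚ L < 7)
    (hzeta : ∀ n : ℕ, Nat.card {I : Ideal (𝓞 K) // Ideal.absNorm I = n}
      = Nat.card {I : Ideal (𝓞 L) // Ideal.absNorm I = n}) :
    Nonempty (K ≃ₐ[ℚ] L) := by
  obtain ⟨f⟩ := embed_main K L hdeg hzeta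
  obtain ⟨g⟩ := embed_main L K hdeg' (fun n => (hzeta n).symm)
  have h1 := LinearMap.finrank_le_finrank_of_injective (f := f.toLinearMap) f.injective
  have h2 := LinearMap.finrank_le_finrank_of_injective (f := g.toLinearMap) g.injective
  exact ⟨AlgEquiv.ofBijective g ⟨g.injective,
    (LinearMap.injective_iff_surjective_of_finrank_eq_finrank (f := g.toLinearMap)
      (le_antisymm h2 h1)).mp g.injective⟩⟩
end
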